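/- Let r ∈ ℕ. Then H_{2,0,3}(3^r) = −3^{3r/2}·δ_{2∣r} − (27/13)·(3^{3⌊(r−1)/2⌋}−1) + 3^r·(3^r−1) − 3^{r+1}·(3^{⌊(r−1)/2⌋}−1) − 3^{3r/2}·δ_{2∣r}, and for m ∈ {1,2}, H_{2,m,3}(3^r) = −1 + 3^{2r} − (3^r/2)·(3^{⌊(r+1)/2⌋}−1) + 3^{r+1}·(3^{⌊(r−1)/2⌋}−1)/2. -/

import Mathlib

open scoped BigOperators

namespace HurwitzPaper

/-- Evaluation of the binary quadratic form `(a,b,c)` (i.e. `a x² + b x y + c y²`). -/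
def formEval (Q : ℤ × ℤ × ℤ) (x y : ℤ) : ℤ :=
  Q.1 * x ^ 2 + Q.2.1 * x * y + Q.2.2 * y ^ 2

/-- Discriminant `b² - 4ac` of the form `(a,b,c)`. -/
def formDisc (Q : ℤ × ℤ × ℤ) : ℤ := Q.2.1 ^ 2 - 4 * Q.1 * Q.2.2

/-- Right action of `γ ∈ SL₂(ℤ)` on a binary quadratic form: `(Q∘γ)(x,y) = Q(ax+by, cx+dy)`. -/
def formAct (γ : Matrix.SpecialLinearGroup (Fin 2) ℤ) (Q : ℤ × ℤ × ℤ) : ℤ × ℤ × ℤ :=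
  (formEval Q (γ.1 0 0) (γ.1 1 0),
   formEval Q (γ.1 0 0 + γ.1 0 1) (γ.1 1 0 + γ.1 1 1)
     - formEval Q (γ.1 0 0) (γ.1 1 0) - formEval Q (γ.1 0 1) (γ.1 1 1),
   formEval Q (γ.1 0 1) (γ.1 1 1))

/-- A form is positive definite iff its leading coefficient is positive and its
discriminant is negative. -/
def IsPosDef (Q : ℤ × ℤ × ℤ) : Prop := 0 < Q.1 ∧ formDisc Q < 0

/-- `SL₂(ℤ)`-equivalence classes of positive definite integral binary quadratic forms
of discriminant `-N`. -/
abbrev FormClasses (N : ℤ) :=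
  Quot (fun (Q Q' : {Q : ℤ × ℤ × ℤ // formDisc Q = -N ∧ IsPosDef Q}) =>
    ∃ γ : Matrix.SpecialLinearGroup (Fin 2) ℤ, formAct γ Q.1 = Q'.1)

/-- The Hurwitz class number `H(N)`: each class of positive definite forms of
discriminant `-N` is counted with weight `1/ω_Q = 2/#Γ_Q`, where `Γ_Q` is the stabilizer
of (a representative of) the class in `SL₂(ℤ)`; `H(0) = -1/12`, and `H(N) = 0` when no
such forms exist (in particular for `N < 0` and `N ≡ 1, 2 (mod 4)`). -/
noncomputable def hurwitzClassNumber (N : ℤ) : ℝ :=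
  if N = 0 then -(1 / 12)
  else ∑ᶠ c : FormClasses N,
    (2 : ℝ) / (Nat.card {γ : Matrix.SpecialLinearGroup (Fin 2) ℤ //
      formAct γ c.out.1 = c.out.1})

/-- `H_{κ,m,M}(n) = ∑_{t ≡ m (mod M)} t^κ H(4n - t²)`. -/
noncomputable def HH (κ : ℕ) (m : ℤ) (M : ℕ) (n : ℕ) : ℝ :=
  ∑ᶠ t : ℤ, if t % (M : ℤ) = m % (M : ℤ) then
    (t : ℝ) ^ κ * hurwitzClassNumber (4 * n - t ^ 2) else 0

/-- `a(n)`: the `n`-th Fourier coefficient of `η(3τ)⁸ = q ∏_{k≥1} (1-q^{3k})⁸`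
(the factors with `k > n` do not affect the coefficient of `q^n`). -/
noncomputable def etaCoeff (n : ℕ) : ℤ :=
  Polynomial.coeff (Polynomial.X * ∏ k ∈ Finset.Icc 1 n, (1 - Polynomial.X ^ (3 * k)) ^ 8 : Polynomial ℤ) n


section
set_option linter.unusedSimpArgs false
set_option linter.all false

/-- rational valued sign -/
def sg (z : ℤ) : ℚ := (Int.sign z : ℚ)
lemma sg_pos {z : ℤ} (h : 0 < z) : sg z = 1 := by simp [sg, Int.sign_eq_one_of_pos h]
lemma sg_neg {z : ℤ} (h : z < 0) : sg z = -1 := by simp [sg, Int.sign_eq_neg_one_of_neg h]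
lemma sg_zero {z : ℤ} (h : z = 0) : sg z = 0 := by simp [sg, h]

/-- weight of the reduced domain -/
def wI (x y a c : ℤ) : ℚ :=
  (1 + sg (a - x + y)) / 2 * ((1 + sg (a + x - y)) / 2) * ((1 + sg (c - x + y)) / 2)
    * ((1 + sg (c + x - y)) / 2)
  + 1 / 12 * (1 - sg (a - c) ^ 2) * (1 - sg (a - x + y) ^ 2 * sg (a + x - y) ^ 2)

def wII (x y a c : ℤ) : ℚ :=
  sg (c - y) * (1 + sg (c - y)) / 2 *
  ((1 + sg (y - x)) / 2 * ((1 + sg (a + y - c)) / 2)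
    + 1 / 12 * (1 - sg (y - x) ^ 2) * (1 - sg (a + y - c) ^ 2))

def WT (x y a c : ℤ) : ℚ :=
  wI x y a c * ((x : ℚ) + y) ^ 2 + wII x y a c * ((x : ℚ) + y - c) ^ 2

def Tsym (x y a c : ℤ) : ℚ :=
  WT x y a c + WT y x a c + WT x y c a + WT y x c a
  + WT a c x y + WT a c y x + WT c a x y + WT c a y x

def P2 (p q t : ℚ) : ℚ := 6*p^2+4*p*q+4*p*t-2*q^2+4*q*t+2*t^2
def P3 (p q r t : ℚ) : ℚ := 4*p^2+4*p*t-2*q^2-r^2-2*r*t+3*t^2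
def P4 (p q r t : ℚ) : ℚ := 2*p^2+4*p*r-4*p*t-4*q^2-4*q*t
def PJ (p q r t : ℚ) : ℚ := 2*(p+t)^2+2*q^2+4*p*r

def phiCore (s1 s2 e u w d : ℚ) (p q r t : ℚ) : ℚ :=
  1/4*((1+s1)*(1+s2)*P2 p q t - (1-s1)*(1-s2)*P2 q p r
    + (1+s1)*(1-s2)*(1/2)*((1+e)*P3 p q r t - (1-e)*P3 q p t r)
    + (1-s1)*(1+s2)*(1/2)*((1+e)*P4 p q r t - (1-e)*P4 q p t r))
  + (1+u)/2*PJ p q r t - (1+w)/2*PJ q p t r + d*(p^2-q^2)/2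

/-- antisymmetric flow on flags -/
def phi (p q r t : ℤ) : ℚ :=
  phiCore (sg (q-t)) (sg (r-p)) (sg (r+q-p-t)) (sg (q-p-t)) (sg (p-q-r))
    ((1 - sg (q-t)^2) * (1 - sg (r-p)^2)) p q r t

lemma sg_neg' (z : ℤ) : sg (-z) = - sg z := by simp [sg]

lemma phi_anti (p q r t : ℤ) : phi q p t r = - phi p q r t := by
  unfold phi
  rw [show p - r = -(r-p) by ring, show t - q = -(q-t) by ring,
    show t + p - q - r = -(r+q-p-t) by ring, sg_neg', sg_neg', sg_neg']
  unfold phiCore; ring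

def gf (x y a c : ℤ) : ℚ := if y < a then phi y c x (a - y) else 0

def Gsym (x y a c : ℤ) : ℚ :=
  gf x y a c + gf y x a c + gf x y c a + gf y x c a
  + gf a c x y + gf a c y x + gf c a x y + gf c a y x

/-- tie contribution, `T` the tied value -/
def ET (T l h : ℤ) : ℚ :=
  1/4*((1+sg (l-T))*(1+sg (h-T))*(8*T^2+4*T*(l+h))
   + (1-sg (l-T))*(1+sg (h-T))*(6*T^2+4*T*l-2*l^2)
   + (1+sg (l-T))*(1-sg (h-T))*(6*T^2+4*T*h-2*h^2)
   + (1-sg (l-T))*(1-sg (h-T))*((1+sg (l+h-T))/2*(4*T^2-2*l^2-2*h^2)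
      + (1-sg (l+h-T))/2*(-6*l^2-8*l*h-6*h^2)))

def dl (z : ℤ) : ℚ := if z = 0 then 1 else 0

def Esym (x y a c : ℤ) : ℚ :=
  dl (x-a) * ET x y c + dl (y-a) * ET y x c + dl (x-c) * ET x y a + dl (y-c) * ET y x a


lemma sg_cases (z : ℤ) : (z < 0 ∧ sg z = -1) ∨ (z = 0 ∧ sg z = 0) ∨ (0 < z ∧ sg z = 1) := by
  rcases lt_trichotomy z 0 with h | h | h
  · exact Or.inl ⟨h, sg_neg h⟩
  · exact Or.inr (Or.inl ⟨h, sg_zero h⟩)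
  · exact Or.inr (Or.inr ⟨h, sg_pos h⟩)

lemma dl_eq (z : ℤ) : dl z = 1 - sg z ^ 2 := by
  unfold dl
  rcases sg_cases z with ⟨h, e⟩ | ⟨h, e⟩ | ⟨h, e⟩ <;> rw [e]
  · rw [if_neg (by omega)]; norm_num
  · rw [if_pos h]; norm_num
  · rw [if_neg (by omega)]; norm_num

lemma gf_eq (x y a c : ℤ) : gf x y a c = sg (a - y) * (1 + sg (a - y)) / 2 *
    phiCore (sg (y + c - a)) (sg (x - y)) (sg (x + c - a)) (sg (c - a)) (sg (y - c - x))
    ((1 - sg (y + c - a)^2) * (1 - sg (x - y)^2)) y c x (a - y) := by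
  unfold gf phi
  rw [show c - (a - y) = y + c - a by ring, show x + c - y - (a - y) = x + c - a by ring,
    show c - y - (a - y) = c - a by ring]
  push_cast
  rcases sg_cases (a - y) with ⟨h, e⟩ | ⟨h, e⟩ | ⟨h, e⟩ <;> rw [e]
  · rw [if_neg (by omega)]; ring
  · rw [if_neg (by omega)]; ring
  · rw [if_pos (by omega)]; ring

set_option maxHeartbeats 4000000 in
lemma point_std (x y a c : ℤ) (hx : 0 < x) (ha : 0 < a) (hxy : x ≤ y) (hac : a ≤ c) (hyc : y ≤ c) :
    Tsym x y a c = Gsym x y a c + Esym x y a c := by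
  unfold Tsym Gsym Esym
  simp only [dl_eq, gf_eq]
  have k1 : sg (x + a - y) = sg (a + x - y) := by congr 1; ring
  have k2 : sg (a - y + x) = sg (a + x - y) := by congr 1; ring
  have k3 : sg (x - y + a) = sg (a + x - y) := by congr 1; ring
  have k4 : sg (y - a - x) = - sg (a + x - y) := by rw [← sg_neg']; congr 1; ring
  have k5 : sg (y - x - a) = - sg (a + x - y) := by rw [← sg_neg']; congr 1; ring
  have k6 : sg (y + a - x) = sg (a + y - x) := by congr 1; ring
  have k7 : sg (a - x + y) = sg (a + y - x) := by congr 1; ring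
  have k8 : sg (y - x + a) = sg (a + y - x) := by congr 1; ring
  have k9 : sg (x - a - y) = - sg (a + y - x) := by rw [← sg_neg']; congr 1; ring
  have k10 : sg (x - y - a) = - sg (a + y - x) := by rw [← sg_neg']; congr 1; ring
  have k11 : sg (x + c - y) = sg (c + x - y) := by congr 1; ring
  have k12 : sg (c - y + x) = sg (c + x - y) := by congr 1; ring
  have k13 : sg (x - y + c) = sg (c + x - y) := by congr 1; ring
  have k14 : sg (y - c - x) = - sg (c + x - y) := by rw [← sg_neg']; congr 1; ring
  have k15 : sg (y - x - c) = - sg (c + x - y) := by rw [← sg_neg']; congr 1; ring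
  have k16 : sg (y + c - x) = sg (c + y - x) := by congr 1; ring
  have k17 : sg (c - x + y) = sg (c + y - x) := by congr 1; ring
  have k18 : sg (y - x + c) = sg (c + y - x) := by congr 1; ring
  have k19 : sg (x - c - y) = - sg (c + y - x) := by rw [← sg_neg']; congr 1; ring
  have k20 : sg (x - y - c) = - sg (c + y - x) := by rw [← sg_neg']; congr 1; ring
  have k21 : sg (a + x - c) = sg (x + a - c) := by congr 1; ring
  have k22 : sg (x - c + a) = sg (x + a - c) := by congr 1; ring
  have k23 : sg (a - c + x) = sg (x + a - c) := by congr 1; ring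
  have k24 : sg (c - x - a) = - sg (x + a - c) := by rw [← sg_neg']; congr 1; ring
  have k25 : sg (c - a - x) = - sg (x + a - c) := by rw [← sg_neg']; congr 1; ring
  have k26 : sg (c + x - a) = sg (x + c - a) := by congr 1; ring
  have k27 : sg (x - a + c) = sg (x + c - a) := by congr 1; ring
  have k28 : sg (c - a + x) = sg (x + c - a) := by congr 1; ring
  have k29 : sg (a - x - c) = - sg (x + c - a) := by rw [← sg_neg']; congr 1; ring
  have k30 : sg (a - c - x) = - sg (x + c - a) := by rw [← sg_neg']; congr 1; ring
  have k31 : sg (a + y - c) = sg (y + a - c) := by congr 1; ring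
  have k32 : sg (y - c + a) = sg (y + a - c) := by congr 1; ring
  have k33 : sg (a - c + y) = sg (y + a - c) := by congr 1; ring
  have k34 : sg (c - y - a) = - sg (y + a - c) := by rw [← sg_neg']; congr 1; ring
  have k35 : sg (c - a - y) = - sg (y + a - c) := by rw [← sg_neg']; congr 1; ring
  have k36 : sg (c + y - a) = sg (y + c - a) := by congr 1; ring
  have k37 : sg (y - a + c) = sg (y + c - a) := by congr 1; ring
  have k38 : sg (c - a + y) = sg (y + c - a) := by congr 1; ring
  have k39 : sg (a - y - c) = - sg (y + c - a) := by rw [← sg_neg']; congr 1; ring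
  have k40 : sg (a - c - y) = - sg (y + c - a) := by rw [← sg_neg']; congr 1; ring
  have k41 : sg (y - x) = - sg (x - y) := by rw [← sg_neg']; congr 1; ring
  have k42 : sg (c - a) = - sg (a - c) := by rw [← sg_neg']; congr 1; ring
  have k43 : sg (c - y) = - sg (y - c) := by rw [← sg_neg']; congr 1; ring
  have k44 : sg (c - x) = - sg (x - c) := by rw [← sg_neg']; congr 1; ring
  have k45 : sg (x - a) = - sg (a - x) := by rw [← sg_neg']; congr 1; ring
  have k46 : sg (y - a) = - sg (a - y) := by rw [← sg_neg']; congr 1; ring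
  unfold WT wI wII ET
  simp only [k1, k2, k3, k4, k5, k6, k7, k8, k9, k10, k11, k12, k13, k14, k15, k16, k17, k18, k19, k20, k21, k22, k23, k24, k25, k26, k27, k28, k29, k30, k31, k32, k33, k34, k35, k36, k37, k38, k39, k40, k41, k42, k43, k44, k45, k46]
  clear k1 k2 k3 k4 k5 k6 k7 k8 k9 k10 k11 k12 k13 k14 k15 k16 k17 k18 k19 k20 k21 k22 k23 k24 k25 k26 k27 k28 k29 k30 k31 k32 k33 k34 k35 k36 k37 k38 k39 k40 k41 k42 k43 k44 k45 k46
  have es2 : sg (a + y - x) = 1 := sg_pos (by omega)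
  have es3 : sg (c + x - y) = 1 := sg_pos (by omega)
  have es4 : sg (c + y - x) = 1 := sg_pos (by omega)
  have es6 : sg (x + c - a) = 1 := sg_pos (by omega)
  have es8 : sg (y + c - a) = 1 := sg_pos (by omega)
  simp only [es2, es3, es4, es6, es8]
  clear es2 es3 es4 es6 es8
  obtain ⟨s9, es9⟩ : ∃ s, sg (x - y) = s := ⟨_, rfl⟩
  obtain ⟨s10, es10⟩ : ∃ s, sg (a - c) = s := ⟨_, rfl⟩
  obtain ⟨s11, es11⟩ : ∃ s, sg (y - c) = s := ⟨_, rfl⟩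
  obtain ⟨s12, es12⟩ : ∃ s, sg (x - c) = s := ⟨_, rfl⟩
  obtain ⟨s13, es13⟩ : ∃ s, sg (a - x) = s := ⟨_, rfl⟩
  obtain ⟨s14, es14⟩ : ∃ s, sg (a - y) = s := ⟨_, rfl⟩
  obtain ⟨s1, es1⟩ : ∃ s, sg (a + x - y) = s := ⟨_, rfl⟩
  obtain ⟨s5, es5⟩ : ∃ s, sg (x + a - c) = s := ⟨_, rfl⟩
  obtain ⟨s7, es7⟩ : ∃ s, sg (y + a - c) = s := ⟨_, rfl⟩
  simp only [es9, es10, es11, es12, es13, es14, es1, es5, es7]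
  rcases sg_cases (x - y) with ⟨hs9, fs9⟩ | ⟨hs9, fs9⟩ | ⟨hs9, fs9⟩ <;> try omega
  all_goals rcases sg_cases (a - c) with ⟨hs10, fs10⟩ | ⟨hs10, fs10⟩ | ⟨hs10, fs10⟩ <;> try omega
  all_goals rcases sg_cases (y - c) with ⟨hs11, fs11⟩ | ⟨hs11, fs11⟩ | ⟨hs11, fs11⟩ <;> try omega
  all_goals rcases sg_cases (x - c) with ⟨hs12, fs12⟩ | ⟨hs12, fs12⟩ | ⟨hs12, fs12⟩ <;> try omega
  all_goals
    rw [es9] at fs9; clear es9; subst fs9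
    rw [es10] at fs10; clear es10; subst fs10
    rw [es11] at fs11; clear es11; subst fs11
    rw [es12] at fs12; clear es12; subst fs12
    try norm_num only [zero_mul, mul_zero, zero_add, add_zero, one_mul, mul_one]
  all_goals rcases sg_cases (a - x) with ⟨hs13, fs13⟩ | ⟨hs13, fs13⟩ | ⟨hs13, fs13⟩ <;> try omega
  all_goals rcases sg_cases (a - y) with ⟨hs14, fs14⟩ | ⟨hs14, fs14⟩ | ⟨hs14, fs14⟩ <;> try omega
  all_goals
    rw [es13] at fs13; clear es13; subst fs13
    rw [es14] at fs14; clear es14; subst fs14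
    try norm_num only [zero_mul, mul_zero, zero_add, add_zero, one_mul, mul_one]
  all_goals rcases sg_cases (a + x - y) with ⟨hs1, fs1⟩ | ⟨hs1, fs1⟩ | ⟨hs1, fs1⟩ <;> try omega
  all_goals rcases sg_cases (x + a - c) with ⟨hs5, fs5⟩ | ⟨hs5, fs5⟩ | ⟨hs5, fs5⟩ <;> try omega
  all_goals rcases sg_cases (y + a - c) with ⟨hs7, fs7⟩ | ⟨hs7, fs7⟩ | ⟨hs7, fs7⟩ <;> try omega
  all_goals
    rw [es1] at fs1; clear es1; subst fs1
    rw [es5] at fs5; clear es5; subst fs5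
    rw [es7] at fs7; clear es7; subst fs7
    try norm_num only [zero_mul, mul_zero, zero_add, add_zero, one_mul, mul_one]
    try unfold phiCore P2 P3 P4 PJ
    try norm_num only [zero_mul, mul_zero, zero_add, add_zero, one_mul, mul_one]
    try (have hh : a = c := (by omega); subst hh)
    try (have hh : y = c := (by omega); subst hh)
    try (have hh : x + a = c := (by omega); subst hh)
    try (have hh : y + a = c := (by omega); subst hh)
    try (have hh : x = y := (by omega); subst hh)
    try (have hh : a = y := (by omega); subst hh)
    try (have hh : x + a = y := (by omega); subst hh)
    try (have hh : x = a := (by omega); subst hh)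
    try push_cast
    ring
end

section
lemma ET_symm (T l h : ℤ) : ET T l h = ET T h l := by
  unfold ET; rw [show h + l = l + h by ring]; ring

lemma Tsym_s1 (x y a c : ℤ) : Tsym y x a c = Tsym x y a c := by unfold Tsym; ring
lemma Tsym_s2 (x y a c : ℤ) : Tsym x y c a = Tsym x y a c := by unfold Tsym; ring
lemma Tsym_s3 (x y a c : ℤ) : Tsym a c x y = Tsym x y a c := by unfold Tsym; ring
lemma Gsym_s1 (x y a c : ℤ) : Gsym y x a c = Gsym x y a c := by unfold Gsym; ring
lemma Gsym_s2 (x y a c : ℤ) : Gsym x y c a = Gsym x y a c := by unfold Gsym; ring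
lemma Gsym_s3 (x y a c : ℤ) : Gsym a c x y = Gsym x y a c := by unfold Gsym; ring
lemma Esym_s1 (x y a c : ℤ) : Esym y x a c = Esym x y a c := by unfold Esym; ring
lemma Esym_s2 (x y a c : ℤ) : Esym x y c a = Esym x y a c := by unfold Esym; ring
lemma dlET (x a y c : ℤ) : dl (a - x) * ET a c y = dl (x - a) * ET x y c := by
  unfold dl
  by_cases h : x = a
  · subst h; rw [ET_symm]
  · rw [if_neg (by omega), if_neg (by omega)]; ring
lemma Esym_s3 (x y a c : ℤ) : Esym a c x y = Esym x y a c := by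
  unfold Esym; rw [dlET, dlET x c, dlET y a, dlET y c]; ring

lemma point_std2 (x y a c : ℤ) (hx : 0 < x) (hy : 0 < y) (ha : 0 < a) (hc : 0 < c)
    (hyc : x ≤ c) (h2 : y ≤ c) (h3 : a ≤ c):
    Tsym x y a c = Gsym x y a c + Esym x y a c := by
  rcases le_total x y with h | h
  · exact point_std x y a c hx ha h h3 h2
  · rw [← Tsym_s1, ← Gsym_s1, ← Esym_s1]; exact point_std y x a c hy ha h h3 hyc

lemma point_std3 (x y a c : ℤ) (hx : 0 < x) (hy : 0 < y) (ha : 0 < a) (hc : 0 < c)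
    (hyc : x ≤ max a c) (h2 : y ≤ max a c) :
    Tsym x y a c = Gsym x y a c + Esym x y a c := by
  rcases le_total a c with h | h
  · rw [max_eq_right h] at *; exact point_std2 x y a c hx hy ha hc hyc h2 h
  · rw [max_eq_left h] at *
    rw [← Tsym_s2, ← Gsym_s2, ← Esym_s2]; exact point_std2 x y c a hx hy hc ha hyc h2 h

lemma point (x y a c : ℤ) (hx : 0 < x) (hy : 0 < y) (ha : 0 < a) (hc : 0 < c) :
    Tsym x y a c = Gsym x y a c + Esym x y a c := by
  rcases le_total (max x y) (max a c) with h | h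
  · exact point_std3 x y a c hx hy ha hc (by omega) (by omega)
  · rw [← Tsym_s3, ← Gsym_s3, ← Esym_s3]
    exact point_std3 a c x y ha hc hx hy (by omega) (by omega)

abbrev Z4 := ℤ × ℤ × ℤ × ℤ

/-- the finite set of positive quadruples with `xy+ac=n` -/
noncomputable def Pn (n : ℤ) : Finset Z4 :=
  (Finset.Icc 1 n ×ˢ Finset.Icc 1 n ×ˢ Finset.Icc 1 n ×ˢ Finset.Icc 1 n).filter
    (fun v => v.1 * v.2.1 + v.2.2.1 * v.2.2.2 = n)

lemma mem_Pn {n x y a c : ℤ} : (x, y, a, c) ∈ Pn n ↔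
    0 < x ∧ 0 < y ∧ 0 < a ∧ 0 < c ∧ x * y + a * c = n := by
  simp only [Pn, Finset.mem_filter, Finset.mem_product, Finset.mem_Icc]
  constructor
  · rintro ⟨⟨h1, h2, h3, h4⟩, h⟩; exact ⟨by omega, by omega, by omega, by omega, h⟩
  · rintro ⟨h1, h2, h3, h4, h⟩
    have := mul_pos h1 h2
    have := mul_pos h3 h4
    refine ⟨⟨⟨h1, ?_⟩, ⟨h2, ?_⟩, ⟨h3, ?_⟩, ⟨h4, ?_⟩⟩, h⟩ <;> nlinarith

lemma sumP_s1 (n : ℤ) (f : ℤ → ℤ → ℤ → ℤ → ℚ) :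
    ∑ v ∈ Pn n, f v.2.1 v.1 v.2.2.1 v.2.2.2 = ∑ v ∈ Pn n, f v.1 v.2.1 v.2.2.1 v.2.2.2 := by
  refine Finset.sum_nbij' (fun v => (v.2.1, v.1, v.2.2.1, v.2.2.2))
    (fun v => (v.2.1, v.1, v.2.2.1, v.2.2.2)) ?_ ?_ ?_ ?_ ?_
  · rintro ⟨x, y, a, c⟩ h
    rw [mem_Pn] at h ⊢; obtain ⟨h1, h2, h3, h4, h5⟩ := h
    exact ⟨h2, h1, h3, h4, by linarith⟩
  · rintro ⟨x, y, a, c⟩ h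
    rw [mem_Pn] at h ⊢; obtain ⟨h1, h2, h3, h4, h5⟩ := h
    exact ⟨h2, h1, h3, h4, by linarith⟩
  all_goals intros; rfl

lemma sumP_s2 (n : ℤ) (f : ℤ → ℤ → ℤ → ℤ → ℚ) :
    ∑ v ∈ Pn n, f v.1 v.2.1 v.2.2.2 v.2.2.1 = ∑ v ∈ Pn n, f v.1 v.2.1 v.2.2.1 v.2.2.2 := by
  refine Finset.sum_nbij' (fun v => (v.1, v.2.1, v.2.2.2, v.2.2.1))
    (fun v => (v.1, v.2.1, v.2.2.2, v.2.2.1)) ?_ ?_ ?_ ?_ ?_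
  · rintro ⟨x, y, a, c⟩ h
    rw [mem_Pn] at h ⊢; obtain ⟨h1, h2, h3, h4, h5⟩ := h
    exact ⟨h1, h2, h4, h3, by linarith⟩
  · rintro ⟨x, y, a, c⟩ h
    rw [mem_Pn] at h ⊢; obtain ⟨h1, h2, h3, h4, h5⟩ := h
    exact ⟨h1, h2, h4, h3, by linarith⟩
  all_goals intros; rfl

lemma sumP_s3 (n : ℤ) (f : ℤ → ℤ → ℤ → ℤ → ℚ) :
    ∑ v ∈ Pn n, f v.2.2.1 v.2.2.2 v.1 v.2.1 = ∑ v ∈ Pn n, f v.1 v.2.1 v.2.2.1 v.2.2.2 := by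
  refine Finset.sum_nbij' (fun v => (v.2.2.1, v.2.2.2, v.1, v.2.1))
    (fun v => (v.2.2.1, v.2.2.2, v.1, v.2.1)) ?_ ?_ ?_ ?_ ?_
  · rintro ⟨x, y, a, c⟩ h
    rw [mem_Pn] at h ⊢; obtain ⟨h1, h2, h3, h4, h5⟩ := h
    exact ⟨h3, h4, h1, h2, by linarith⟩
  · rintro ⟨x, y, a, c⟩ h
    rw [mem_Pn] at h ⊢; obtain ⟨h1, h2, h3, h4, h5⟩ := h
    exact ⟨h3, h4, h1, h2, by linarith⟩
  all_goals intros; rfl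

lemma sumP_sym (n : ℤ) (f : ℤ → ℤ → ℤ → ℤ → ℚ) :
    ∑ v ∈ Pn n, (f v.1 v.2.1 v.2.2.1 v.2.2.2 + f v.2.1 v.1 v.2.2.1 v.2.2.2
      + f v.1 v.2.1 v.2.2.2 v.2.2.1 + f v.2.1 v.1 v.2.2.2 v.2.2.1
      + f v.2.2.1 v.2.2.2 v.1 v.2.1 + f v.2.2.1 v.2.2.2 v.2.1 v.1
      + f v.2.2.2 v.2.2.1 v.1 v.2.1 + f v.2.2.2 v.2.2.1 v.2.1 v.1)
    = 8 * ∑ v ∈ Pn n, f v.1 v.2.1 v.2.2.1 v.2.2.2 := by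
  simp only [Finset.sum_add_distrib]
  rw [sumP_s1 n f, sumP_s2 n f, sumP_s2 n (fun x y a c => f y x a c), sumP_s1 n f,
    sumP_s3 n f, sumP_s3 n (fun x y a c => f x y c a), sumP_s2 n f,
    sumP_s3 n (fun x y a c => f y x a c), sumP_s1 n f,
    sumP_s3 n (fun x y a c => f y x c a), sumP_s2 n (fun x y a c => f y x a c), sumP_s1 n f]
  ring

lemma sum_gf (n : ℤ) : ∑ v ∈ Pn n, gf v.1 v.2.1 v.2.2.1 v.2.2.2 = 0 := by
  have h0 : ∑ v ∈ Pn n, gf v.1 v.2.1 v.2.2.1 v.2.2.2 =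
      ∑ v ∈ (Pn n).filter (fun v => v.2.1 < v.2.2.1),
        phi v.2.1 v.2.2.2 v.1 (v.2.2.1 - v.2.1) := by
    rw [Finset.sum_filter]; rfl
  rw [h0]
  have h1 : ∑ v ∈ (Pn n).filter (fun v => v.2.1 < v.2.2.1),
        phi v.2.1 v.2.2.2 v.1 (v.2.2.1 - v.2.1) =
      ∑ v ∈ (Pn n).filter (fun v => v.2.1 < v.2.2.1),
        - phi v.2.1 v.2.2.2 v.1 (v.2.2.1 - v.2.1) := by
    refine Finset.sum_nbij' (fun v => (v.2.2.1 - v.2.1, v.2.2.2, v.2.2.2 + v.1, v.2.1))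
      (fun v => (v.2.2.1 - v.2.1, v.2.2.2, v.2.2.2 + v.1, v.2.1)) ?_ ?_ ?_ ?_ ?_
    · rintro ⟨x, y, a, c⟩ h
      rw [Finset.mem_filter, mem_Pn] at h ⊢
      obtain ⟨⟨h1, h2, h3, h4, h5⟩, h6⟩ := h
      dsimp only at h6 ⊢
      refine ⟨⟨by omega, by omega, by omega, by omega, by linarith⟩, by omega⟩
    · rintro ⟨x, y, a, c⟩ h
      rw [Finset.mem_filter, mem_Pn] at h ⊢
      obtain ⟨⟨h1, h2, h3, h4, h5⟩, h6⟩ := h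
      dsimp only at h6 ⊢
      refine ⟨⟨by omega, by omega, by omega, by omega, by linarith⟩, by omega⟩
    · rintro ⟨x, y, a, c⟩ h; ext <;> dsimp only <;> omega
    · rintro ⟨x, y, a, c⟩ h; ext <;> dsimp only <;> omega
    · rintro ⟨x, y, a, c⟩ h
      dsimp only
      rw [show c + x - c = x by ring, phi_anti y c x (a - y), neg_neg]
  rw [Finset.sum_neg_distrib] at h1
  linarith

lemma sum_WT_eq (n : ℤ) : ∑ v ∈ Pn n, WT v.1 v.2.1 v.2.2.1 v.2.2.2 =
    1 / 2 * ∑ v ∈ Pn n, dl (v.1 - v.2.2.1) * ET v.1 v.2.1 v.2.2.2 := by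
  have hT := sumP_sym n WT
  have hG := sumP_sym n gf
  rw [sum_gf] at hG
  have hE : ∑ v ∈ Pn n, Esym v.1 v.2.1 v.2.2.1 v.2.2.2 =
      4 * ∑ v ∈ Pn n, dl (v.1 - v.2.2.1) * ET v.1 v.2.1 v.2.2.2 := by
    unfold Esym
    simp only [Finset.sum_add_distrib]
    rw [sumP_s1 n (fun x y a c => dl (x - a) * ET x y c),
      sumP_s2 n (fun x y a c => dl (x - a) * ET x y c),
      sumP_s2 n (fun x y a c => dl (y - a) * ET y x c),
      sumP_s1 n (fun x y a c => dl (x - a) * ET x y c)]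
    ring
  have hp : ∑ v ∈ Pn n, Tsym v.1 v.2.1 v.2.2.1 v.2.2.2 =
      ∑ v ∈ Pn n, (Gsym v.1 v.2.1 v.2.2.1 v.2.2.2 + Esym v.1 v.2.1 v.2.2.1 v.2.2.2) := by
    refine Finset.sum_congr rfl ?_
    rintro ⟨x, y, a, c⟩ h
    rw [mem_Pn] at h
    exact point x y a c h.1 h.2.1 h.2.2.1 h.2.2.2.1
  rw [Finset.sum_add_distrib, hE] at hp
  have hT' : ∑ v ∈ Pn n, Tsym v.1 v.2.1 v.2.2.1 v.2.2.2 = 8 * ∑ v ∈ Pn n, WT v.1 v.2.1 v.2.2.1 v.2.2.2 := hT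
  have hG' : ∑ v ∈ Pn n, Gsym v.1 v.2.1 v.2.2.1 v.2.2.2 = 8 * 0 := hG
  rw [hT', hG'] at hp
  linarith
end

section
open Finset

lemma polysum (A B C : ℚ) (T : ℕ) (hT : 1 ≤ T) : ∑ y ∈ Ico 1 T, (A + B * y + C * y^2) =
    A * (T - 1) + B * (T * (T - 1) / 2) + C * ((T - 1) * T * (2 * T - 1) / 6) := by
  induction T, hT using Nat.le_induction with
  | base => simp
  | succ T hT ih => rw [sum_Ico_succ_top hT, ih]; push_cast; ring

def SE (T s : ℕ) : ℚ := ∑ y ∈ Ico 1 s, ET T y (s - y)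

lemma SE_lt (T s : ℕ) (hs : 1 ≤ s) (h : s < T) :
    SE T s = -6*s^2*(s-1) + 4*(s^3-s)/6 := by
  have : SE T s = ∑ y ∈ Ico 1 s, ((-6*s^2 : ℚ) + (4 * s) * y + (-4) * y^2) := by
    refine sum_congr rfl fun y hy => ?_
    rw [mem_Ico] at hy
    unfold ET
    rw [sg_neg (z := (y:ℤ) - T) (by omega), sg_neg (z := (s:ℤ) - y - T) (by omega),
      sg_neg (z := (y:ℤ) + (s - y) - T) (by omega)]
    push_cast; ring
  rw [this, polysum _ _ _ _ hs]; ring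

lemma SE_eq (T : ℕ) (hs : 1 ≤ T) :
    SE T T = -4*((T-1)*T*(2*T-1)/6) := by
  have : SE T T = ∑ y ∈ Ico 1 T, ((-2*T^2 : ℚ) + (4 * T) * y + (-4) * y^2) := by
    refine sum_congr rfl fun y hy => ?_
    rw [mem_Ico] at hy
    unfold ET
    rw [sg_neg (z := (y:ℤ) - T) (by omega), sg_neg (z := (T:ℤ) - y - T) (by omega),
      sg_zero (z := (y:ℤ) + (T - y) - T) (by omega)]
    push_cast; ring
  rw [this, polysum _ _ _ _ hs]; ring

def gg (T s y : ℕ) : ℚ := if y < T then (6*T^2+4*T*y-2*y^2) - (8*T^2+4*T*s)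
  else if y = T then ((8*T^2 : ℚ) - (8*T^2+4*T*s))/2 else 0

lemma SE_gt (T s : ℕ) (hs : 1 ≤ T) (h : 2 * T < s) :
    SE T s = (s - 1) * (8*T^2+4*T*s) + 2 * ((6*T^2-(8*T^2+4*T*s)) * (T - 1)
      + (4*T) * (T * (T - 1) / 2) + (-2) * ((T - 1) * T * (2 * T - 1) / 6))
      - 4 * T * s := by
  have h1 : SE T s = ∑ y ∈ Ico 1 s, (((8*T^2+4*T*s : ℚ) + 0 * y + 0 * y^2) + gg T s y + gg T s (s - y)) := by
    refine sum_congr rfl fun y hy => ?_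
    rw [mem_Ico] at hy
    have hc : ((s - y : ℕ) : ℚ) = s - y := by push_cast [hy.2.le]; ring
    unfold ET gg
    rw [sg_pos (z := (y:ℤ) + (s - y) - T) (by omega)]
    rcases lt_trichotomy y T with h1 | h1 | h1
    · rw [sg_neg (z := (y:ℤ) - T) (by omega), sg_pos (z := (s:ℤ) - y - T) (by omega)]
      simp only [h1, if_true, show ¬ (s - y < T) by omega, show ¬ (s - y = T) by omega, if_false]
      push_cast; ring
    · rw [sg_zero (z := (y:ℤ) - T) (by omega), sg_pos (z := (s:ℤ) - y - T) (by omega)]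
      subst h1
      simp only [lt_irrefl, if_true, show ¬ (s - y < y) by omega, show ¬ (s - y = y) by omega, if_false]
      push_cast; ring
    · rcases lt_trichotomy (s - y) T with h2 | h2 | h2
      · rw [sg_pos (z := (y:ℤ) - T) (by omega), sg_neg (z := (s:ℤ) - y - T) (by omega)]
        simp only [h2, if_true, show ¬ (y < T) by omega, show ¬ (y = T) by omega, if_false, hc]
        push_cast; ring
      · rw [sg_pos (z := (y:ℤ) - T) (by omega), sg_zero (z := (s:ℤ) - y - T) (by omega)]
        have h3 : (s : ℚ) = T + y := by have : s = T + y := by omega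
                                        exact_mod_cast this
        simp only [h2, lt_irrefl, if_true, show ¬ (y < T) by omega, show ¬ (y = T) by omega, if_false]
        push_cast; rw [h3]; ring
      · rw [sg_pos (z := (y:ℤ) - T) (by omega), sg_pos (z := (s:ℤ) - y - T) (by omega)]
        simp only [show ¬ (y < T) by omega, show ¬ (y = T) by omega, 
          show ¬ (s - y < T) by omega, show ¬ (s - y = T) by omega, if_false]
        push_cast; ring
  have h2 : ∑ y ∈ Ico 1 s, gg T s (s - y) = ∑ y ∈ Ico 1 s, gg T s y := by
    refine sum_nbij' (fun y => s - y) (fun y => s - y) ?_ ?_ ?_ ?_ ?_ <;>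
      intro y hy <;> simp only [mem_Ico] at hy ⊢ <;> omega
  have h3 : ∑ y ∈ Ico 1 s, gg T s y = ((6*T^2-(8*T^2+4*T*s)) * (T - 1)
      + (4*T) * (T * (T - 1) / 2) + (-2) * ((T - 1) * T * (2 * T - 1) / 6)) - 2 * T * s := by
    rw [← sum_Ico_consecutive _ hs (show T ≤ s by omega), sum_eq_sum_Ico_succ_bot (show T < s by omega)]
    have e1 : ∑ y ∈ Ico 1 T, gg T s y = ∑ y ∈ Ico 1 T, ((6*T^2-(8*T^2+4*T*s) : ℚ) + (4*T)*y + (-2)*y^2) := by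
      refine sum_congr rfl fun y hy => ?_
      rw [mem_Ico] at hy
      unfold gg; rw [if_pos hy.2]; ring
    have e2 : ∑ y ∈ Ico (T+1) s, gg T s y = 0 := by
      refine sum_eq_zero fun y hy => ?_
      rw [mem_Ico] at hy
      unfold gg; rw [if_neg (by omega), if_neg (by omega)]
    have e3 : gg T s T = - 2 * T * s := by
      unfold gg; rw [if_neg (by omega), if_pos rfl]; ring
    rw [e1, e2, e3, polysum _ _ _ _ hs]; ring
  rw [h1, sum_add_distrib, sum_add_distrib, h2, h3, polysum _ _ _ _ (by omega)]
  ring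

lemma SE_sum (r : ℕ) : ∑ v ∈ Pn (3 ^ r), dl (v.1 - v.2.2.1) * ET v.1 v.2.1 v.2.2.2 =
    ∑ j ∈ range (r + 1), SE (3 ^ j) (3 ^ (r - j)) := by
  have h0 : ∑ v ∈ Pn (3 ^ r), dl (v.1 - v.2.2.1) * ET v.1 v.2.1 v.2.2.2 =
      ∑ v ∈ (Pn (3^r)).filter (fun v => v.1 = v.2.2.1), ET v.1 v.2.1 v.2.2.2 := by
    rw [sum_filter]
    refine sum_congr rfl fun v _ => ?_
    unfold dl
    simp only [sub_eq_zero]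
    split_ifs <;> ring
  rw [h0]; unfold SE
  rw [sum_sigma']
  symm
  refine sum_bij (fun p _ => (((3:ℤ)^p.1, (p.2:ℤ), (3:ℤ)^p.1, (3:ℤ)^(r-p.1) - p.2) : Z4)) ?_ ?_ ?_ ?_
  · rintro ⟨j, y⟩ h
    simp only [mem_sigma, mem_range, mem_Ico] at h
    rw [mem_filter, mem_Pn]
    obtain ⟨h1, h2, h3⟩ := h
    have h3' : (y : ℤ) < 3 ^ (r - j) := by exact_mod_cast h3
    refine ⟨⟨by positivity, by simp; omega, by positivity, by simp; omega, ?_⟩, rfl⟩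
    dsimp only
    rw [← mul_add, add_sub_cancel, ← pow_add]; congr 1; omega
  · rintro ⟨j, y⟩ _ ⟨j', y'⟩ _ h
    simp only [Prod.mk.injEq] at h
    obtain ⟨h1, h2, -⟩ := h
    have : j = j' := by
      have : (3:ℕ)^j = 3^j' := by exact_mod_cast h1
      exact Nat.pow_right_injective (le_refl _ : 2 ≤ 2).step this
    subst this
    have : y = y' := by exact_mod_cast h2
    subst this; rfl
  · rintro ⟨x, y, a, c⟩ h
    rw [mem_filter, mem_Pn] at h
    obtain ⟨⟨h1, h2, h3, h4, h5⟩, h6⟩ := h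
    dsimp only at h6; subst h6
    have hd : x.natAbs ∣ 3 ^ r := by
      have : x ∣ 3 ^ r := ⟨y + c, by linarith⟩
      have := Int.natAbs_dvd_natAbs.mpr this
      rwa [Int.natAbs_pow] at this
    obtain ⟨j, hj, hx⟩ := (Nat.dvd_prime_pow Nat.prime_three).1 hd
    have hx' : x = 3 ^ j := by
      have : (x.natAbs : ℤ) = x := Int.natAbs_of_nonneg h1.le
      rw [← this, hx]; push_cast; rfl
    subst hx'
    have hs : y + c = 3 ^ (r - j) := by
      have e : (3:ℤ)^j * (y + c) = 3 ^ j * 3 ^ (r - j) := by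
        rw [← pow_add, show j + (r - j) = r by omega]; linarith
      exact mul_left_cancel₀ (by positivity) e
    refine ⟨⟨j, y.toNat⟩, ?_, ?_⟩
    · simp only [mem_sigma, mem_range, mem_Ico]
      refine ⟨by omega, by omega, ?_⟩
      zify; rw [Int.toNat_of_nonneg h2.le]; linarith
    · simp only [Int.toNat_of_nonneg h2.le, ← hs, add_sub_cancel_left]
  · rintro ⟨j, y⟩ h
    dsimp only; push_cast; rfl

/-- contribution of a divisor pair -/
def cfun (T s : ℕ) : ℚ := 1/2 * SE T s + (2 * (min T s : ℕ)^3 + (min T s : ℕ))/3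
  - (if T = s then (T:ℚ)^2 else 0)

def qf (T s : ℕ) : ℚ := 2 * (min T s : ℕ) * (max T s : ℕ)^2 - 2 * (min T s : ℕ)^3

lemma cfun_pair_lt (T s : ℕ) (hT : 1 ≤ T) (h : 2 * T < s) : cfun T s + cfun s T = qf T s := by
  unfold cfun qf
  rw [if_neg (by omega), if_neg (by omega), min_comm s T, min_eq_left (by omega), max_eq_right (by omega),
    SE_gt T s hT h, SE_lt s T hT (by omega)]
  ring

lemma cfun_pair (i j : ℕ) : cfun (3^i) (3^j) + cfun (3^j) (3^i) = qf (3^i) (3^j) := by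
  have key : ∀ i j : ℕ, i < j → cfun (3^i) (3^j) + cfun (3^j) (3^i) = qf (3^i) (3^j) := by
    intro i j h
    refine cfun_pair_lt _ _ (Nat.one_le_pow _ _ (by norm_num)) ?_
    have := Nat.pow_le_pow_right (show 0 < 3 by norm_num) (Nat.succ_le_of_lt h)
    have h2 : 0 < 3^i := by positivity
    rw [pow_succ] at this; omega
  rcases lt_trichotomy i j with h | h | h
  · exact key i j h
  · subst h
    unfold cfun qf
    rw [if_pos rfl, min_self, max_self, SE_eq _ (Nat.one_le_pow _ _ (by norm_num))]
    ring
  · rw [add_comm, key j i h]; unfold qf; rw [min_comm, max_comm]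

/-- the total second moment for `3^r` -/
def totR (r : ℕ) : ℚ := ∑ j ∈ range (r + 1), cfun (3^j) (3^(r-j))

lemma totR_eq (r : ℕ) : totR r = 1/2 * ∑ j ∈ range (r + 1), qf (3^j) (3^(r-j)) := by
  have h1 : totR r = ∑ j ∈ range (r + 1), cfun (3^(r-j)) (3^j) := by
    unfold totR
    rw [← sum_range_reflect]
    refine sum_congr rfl fun j hj => ?_
    rw [mem_range] at hj
    congr 2 <;> omega
  have h2 : totR r + totR r = ∑ j ∈ range (r + 1), qf (3^j) (3^(r-j)) := by
    nth_rewrite 2 [h1]; unfold totR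
    rw [← sum_add_distrib]
    exact sum_congr rfl fun j _ => cfun_pair _ _
  linarith

lemma totR_zero : totR 0 = 0 := by rw [totR_eq]; simp [qf]
lemma totR_one : totR 1 = 16 := by rw [totR_eq]; simp [qf, sum_range_succ]; norm_num
lemma qf_three (T s : ℕ) : qf (3 * T) (3 * s) = 27 * qf T s := by
  unfold qf
  rw [show min (3*T) (3*s) = 3 * min T s by omega, show max (3*T) (3*s) = 3 * max T s by omega]; push_cast; ring
lemma totR_succ (r : ℕ) : totR (r + 2) = 27 * totR r + 2 * (9^(r+2) - 1) := by
  rw [totR_eq, totR_eq, sum_range_succ, sum_range_succ']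
  have : ∑ k ∈ range (r + 1), qf (3 ^ (k + 1)) (3 ^ (r + 2 - (k + 1))) =
      27 * ∑ j ∈ range (r + 1), qf (3^j) (3^(r-j)) := by
    rw [mul_sum]
    refine sum_congr rfl fun j hj => ?_
    rw [mem_range] at hj
    rw [← qf_three, pow_succ', show r + 2 - (j+1) = (r - j) + 1 by omega, pow_succ' 3 (r-j)]
  rw [this]
  have h1 : (1:ℕ) ≤ 3^(r+2) := (Nat.one_le_pow _ _ (by norm_num))
  have e : (9:ℚ)^(r+2) = (3^(r+2))^2 := by rw [← pow_mul, mul_comm, pow_mul]; norm_num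
  simp only [qf, Nat.sub_self, pow_zero, Nat.sub_zero, min_eq_left h1, min_eq_right h1, max_eq_left h1, max_eq_right h1, e]
  push_cast; ring
end

section
open Matrix

abbrev F3 := ℤ × ℤ × ℤ
abbrev SLZ := Matrix.SpecialLinearGroup (Fin 2) ℤ

/-- action of a general matrix -/
def fa (p q r s : ℤ) (Q : F3) : F3 :=
  (Q.1 * p^2 + Q.2.1 * p * r + Q.2.2 * r^2,
   2 * Q.1 * p * q + Q.2.1 * (p * s + q * r) + 2 * Q.2.2 * r * s,
   Q.1 * q^2 + Q.2.1 * q * s + Q.2.2 * s^2)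

lemma formAct_eq (γ : SLZ) (Q : F3) : formAct γ Q = fa (γ.1 0 0) (γ.1 0 1) (γ.1 1 0) (γ.1 1 1) Q := by
  unfold formAct fa formEval
  ext <;> dsimp only <;> ring

lemma det_SLZ (γ : SLZ) : γ.1 0 0 * γ.1 1 1 - γ.1 0 1 * γ.1 1 0 = 1 := by
  have := γ.2; rwa [Matrix.det_fin_two] at this

lemma fa_comp (p q r s p' q' r' s' : ℤ) (Q : F3) :
    fa p' q' r' s' (fa p q r s Q) = fa (p*p'+q*r') (p*q'+q*s') (r*p'+s*r') (r*q'+s*s') Q := by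
  unfold fa; ext <;> dsimp only <;> ring

lemma formAct_mul (γ δ : SLZ) (Q : F3) : formAct (γ * δ) Q = formAct δ (formAct γ Q) := by
  rw [formAct_eq, formAct_eq, formAct_eq, fa_comp]
  simp [Matrix.mul_apply, Fin.sum_univ_two]

lemma formAct_one (Q : F3) : formAct 1 Q = Q := by
  rw [formAct_eq]; simp [fa]

lemma formAct_inv {γ : SLZ} {Q Q' : F3} (h : formAct γ Q = Q') : formAct γ⁻¹ Q' = Q := by
  rw [← h, ← formAct_mul, mul_inv_cancel, formAct_one]

lemma formDisc_fa (p q r s : ℤ) (Q : F3) : formDisc (fa p q r s Q) = (p*s-q*r)^2 * formDisc Q := by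
  unfold formDisc fa; dsimp only; ring

lemma formDisc_act (γ : SLZ) (Q : F3) : formDisc (formAct γ Q) = formDisc Q := by
  rw [formAct_eq, formDisc_fa, det_SLZ]; ring

lemma posdef_fa {p q r s : ℤ} {Q : F3} (h : p*s-q*r ≠ 0) (hQ : IsPosDef Q) : IsPosDef (fa p q r s Q) := by
  obtain ⟨h1, h2⟩ := hQ
  refine ⟨?_, ?_⟩
  · obtain ⟨a, b, c⟩ := Q
    unfold formDisc at h2; unfold fa; dsimp only at *
    have key : 4 * a * (a*p^2+b*p*r+c*r^2) = (2*a*p+b*r)^2 + (4*a*c-b^2)*r^2 := by ring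
    by_contra hn
    have h3 : 4 * a * (a*p^2+b*p*r+c*r^2) ≤ 0 := by nlinarith
    have h4 : 0 ≤ (2*a*p+b*r)^2 := sq_nonneg _
    have hr : r = 0 := by
      by_contra hr
      have : 0 < r^2 := by positivity
      nlinarith
    subst hr
    have hp : p = 0 := by
      by_contra hp
      have : 0 < p^2 := by positivity
      nlinarith
    subst hp; simp at h
  · rw [formDisc_fa]
    have : 0 < (p*s-q*r)^2 := by positivity
    nlinarith

lemma posdef_act (γ : SLZ) {Q : F3} (hQ : IsPosDef Q) : IsPosDef (formAct γ Q) := by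
  rw [formAct_eq]; exact posdef_fa (by rw [det_SLZ]; norm_num) hQ

/-- reduced forms -/
def D0 (Q : F3) : Prop := 0 < Q.1 ∧ -Q.1 < Q.2.1 ∧ Q.2.1 ≤ Q.1 ∧ Q.1 ≤ Q.2.2 ∧ (Q.1 = Q.2.2 → 0 ≤ Q.2.1)

instance (Q : F3) : Decidable (D0 Q) := by unfold D0; infer_instance

lemma D0.posdef {Q : F3} (h : D0 Q) : IsPosDef Q := by
  obtain ⟨h1, h2, h3, h4, -⟩ := h
  refine ⟨h1, ?_⟩
  unfold formDisc
  nlinarith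

lemma red_h1 {a b q : ℤ} (h1 : 0 < a) (h2 : -a < b) (h3 : b ≤ a) (h4 : -a < 2*a*q+b)
    (h5 : 2*a*q+b ≤ a) : q = 0 := by
  rcases lt_trichotomy q 0 with h | h | h
  · nlinarith
  · exact h
  · nlinarith

lemma red_h2 {a b u : ℤ} (h1 : 0 < a) (h2 : 0 ≤ b) (h3 : b ≤ a) (h4 : -a < 2*a*u-b)
    (h5 : 2*a*u-b ≤ a) : u = 0 ∨ (u = 1 ∧ b = a) := by
  have : 0 ≤ u := by by_contra hh; nlinarith
  have : u ≤ 1 := by by_contra hh; nlinarith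
  have : u = 0 ∨ u = 1 := by omega
  rcases this with h | h
  · exact Or.inl h
  · subst h; right; exact ⟨rfl, by linarith⟩

/-- structure of maps between reduced forms -/
lemma red_main {a b c p q r s a' b' c' : ℤ} (h : D0 (a, b, c)) (h' : D0 (a', b', c'))
    (hd : p * s - q * r = 1) (e : fa p q r s (a, b, c) = (a', b', c')) (hle : a' ≤ a) :
    (a' = a ∧ b' = b ∧ c' = c) ∧
      ((r = 0 ∧ q = 0 ∧ p = s ∧ (p = 1 ∨ p = -1)) ∨
       (b = 0 ∧ a = c ∧ p = 0 ∧ s = 0 ∧ q = -r ∧ (r = 1 ∨ r = -1)) ∨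
       (a = b ∧ a = c ∧ p = 0 ∧ q = -r ∧ s = r ∧ (r = 1 ∨ r = -1)) ∨
       (a = b ∧ a = c ∧ p = -r ∧ q = -r ∧ s = 0 ∧ (r = 1 ∨ r = -1))) := by
  obtain ⟨h1, h2, h3, h4, h5⟩ := h
  obtain ⟨k1, k2, k3, k4, k5⟩ := h'
  simp only [fa, Prod.mk.injEq] at e
  dsimp only at *
  obtain ⟨e1, e2, e3⟩ := e
  have hb : -a * |p*r| ≤ b * (p * r) := by
    rcases abs_cases (p*r) with ⟨hh, h0⟩ | ⟨hh, h0⟩ <;> rw [hh] <;> nlinarith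
  have hc : a * r^2 ≤ c * r^2 := by nlinarith [sq_nonneg r]
  have h6 : a * (p^2 - |p*r| + r^2) ≤ a * 1 := by nlinarith
  have h7 : p^2 - |p*r| + r^2 ≤ 1 := le_of_mul_le_mul_left h6 h1
  have h8 : p^2 + r^2 ≤ 2 := by
    rcases abs_cases (p*r) with ⟨hh, h0⟩ | ⟨hh, h0⟩ <;> rw [hh] at h7 <;>
      nlinarith [sq_nonneg (p - r), sq_nonneg (p + r)]
  have hp : -1 ≤ p ∧ p ≤ 1 := ⟨by nlinarith [sq_nonneg r], by nlinarith [sq_nonneg r]⟩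
  have hr : -1 ≤ r ∧ r ≤ 1 := ⟨by nlinarith [sq_nonneg p], by nlinarith [sq_nonneg p]⟩
  clear hb hc h6
  have hpv : p = -1 ∨ p = 0 ∨ p = 1 := by omega
  have hrv : r = -1 ∨ r = 0 ∨ r = 1 := by omega
  rcases hrv with rfl | rfl | rfl
  · rcases hpv with rfl | rfl | rfl
    · exfalso; clear h7 h8; linarith
    · have hca : c = a := by linarith
      subst hca
      obtain rfl : q = 1 := by linarith
      have h9 := h5 rfl
      rcases red_h2 (u := -s) h1 h9 h3 (by linarith) (by linarith) with hs | ⟨hs, hb⟩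
      · obtain rfl : s = 0 := by omega
        have : 0 ≤ b' := k5 (by linarith)
        refine ⟨⟨by linarith, by linarith, by linarith⟩, Or.inr (Or.inl ⟨by linarith, rfl, rfl, rfl, by norm_num, by norm_num⟩)⟩
      · obtain rfl : s = -1 := by omega
        refine ⟨⟨by linarith, by linarith, by linarith⟩, Or.inr (Or.inr (Or.inl ⟨by linarith, rfl, rfl, by norm_num, rfl, by norm_num⟩))⟩
    · have hbc : b = c := by linarith
      have hba : a = b := by linarith
      subst hbc; subst hba
      obtain rfl : s = 1 - q := by linarith
      have hq : 2 * (q - 1) = 0 := by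
        have e4 : b' = a * (2 * q - 1) := by linarith
        have : -1 < 2 * q - 1 := by by_contra hh; nlinarith
        have : 2 * q - 1 ≤ 1 := by by_contra hh; nlinarith
        omega
      obtain rfl : q = 1 := by omega
      refine ⟨⟨by linarith, by linarith, by linarith⟩, Or.inr (Or.inr (Or.inr ⟨rfl, rfl, by norm_num, by norm_num, by norm_num, by norm_num⟩))⟩
  · rcases hpv with rfl | rfl | rfl
    · obtain rfl : s = -1 := by linarith
      obtain rfl : q = 0 := by
        have := red_h1 (q := -q) h1 h2 h3 (by linarith) (by linarith)
        omega
      exact ⟨⟨by linarith, by linarith, by linarith⟩, Or.inl (by norm_num)⟩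
    · norm_num at hd
    · obtain rfl : s = 1 := by linarith
      obtain rfl : q = 0 := red_h1 h1 h2 h3 (by linarith) (by linarith)
      exact ⟨⟨by linarith, by linarith, by linarith⟩, Or.inl (by norm_num)⟩
  · rcases hpv with rfl | rfl | rfl
    · have hbc : b = c := by linarith
      have hba : a = b := by linarith
      subst hbc; subst hba
      obtain rfl : s = -1 - q := by linarith
      have hq : 2 * (q + 1) = 0 := by
        have e4 : b' = a * (-2 * q - 1) := by linarith
        have : -1 < -2 * q - 1 := by by_contra hh; nlinarith
        have : -2 * q - 1 ≤ 1 := by by_contra hh; nlinarith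
        omega
      obtain rfl : q = -1 := by omega
      refine ⟨⟨by linarith, by linarith, by linarith⟩, Or.inr (Or.inr (Or.inr ⟨rfl, rfl, by norm_num, by norm_num, by norm_num, by norm_num⟩))⟩
    · have hca : c = a := by linarith
      subst hca
      obtain rfl : q = -1 := by linarith
      have h9 := h5 rfl
      rcases red_h2 (u := s) h1 h9 h3 (by linarith) (by linarith) with hs | ⟨hs, hb⟩
      · subst hs
        have : 0 ≤ b' := k5 (by linarith)
        refine ⟨⟨by linarith, by linarith, by linarith⟩, Or.inr (Or.inl ⟨by linarith, rfl, rfl, rfl, by norm_num, by norm_num⟩)⟩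
      · subst hs
        refine ⟨⟨by linarith, by linarith, by linarith⟩, Or.inr (Or.inr (Or.inl ⟨by linarith, rfl, rfl, by norm_num, rfl, by norm_num⟩))⟩
    · exfalso; clear h7 h8; linarith

lemma red_unique {Q Q' : F3} (h : D0 Q) (h' : D0 Q') {γ : SLZ} (e : formAct γ Q = Q') : Q' = Q := by
  have key : ∀ {Q Q' : F3} (_ : D0 Q) (_ : D0 Q') {γ : SLZ} (_ : formAct γ Q = Q') (_ : Q'.1 ≤ Q.1), Q' = Q := by
    rintro ⟨a, b, c⟩ ⟨a', b', c'⟩ h h' γ e hle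
    rw [formAct_eq] at e
    have := (red_main h h' (det_SLZ γ) e hle).1
    simp only [Prod.mk.injEq]; exact this
  rcases le_total Q'.1 Q.1 with hl | hl
  · exact key h h' e hl
  · exact (key h' h (formAct_inv e) hl).symm

/-- translation -/
def Tm (k : ℤ) : SLZ := ⟨!![1, k; 0, 1], by simp [Matrix.det_fin_two]⟩
def Sm : SLZ := ⟨!![0, -1; 1, 0], by simp [Matrix.det_fin_two]⟩

lemma act_Tm (k a b c : ℤ) : formAct (Tm k) (a, b, c) = (a, b + 2 * a * k, a * k^2 + b * k + c) := by
  rw [formAct_eq]; simp [fa, Tm]; ring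
lemma act_Sm (a b c : ℤ) : formAct Sm (a, b, c) = (c, -b, a) := by
  rw [formAct_eq]; simp [fa, Sm]

lemma exists_red (n : ℕ) : ∀ Q : F3, IsPosDef Q → Q.1.toNat ≤ n → ∃ γ : SLZ, D0 (formAct γ Q) := by
  induction n with
  | zero => intro Q hQ hn; have := hQ.1; omega
  | succ n ih =>
    rintro ⟨a, b, c⟩ hQ hn
    have ha : 0 < a := hQ.1
    -- translate
    obtain ⟨k, hk1, hk2⟩ : ∃ k : ℤ, -a < b + 2*a*k ∧ b + 2*a*k ≤ a := by
      refine ⟨-((b + a - 1) / (2*a)), ?_, ?_⟩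
      · have := Int.emod_add_mul_ediv (b+a-1) (2*a)
        have := Int.emod_nonneg (b+a-1) (show 2*a ≠ 0 by omega)
        nlinarith
      · have := Int.emod_add_mul_ediv (b+a-1) (2*a)
        have := Int.emod_lt_of_pos (b+a-1) (show 0 < 2*a by omega)
        nlinarith
    have hQ2 := posdef_act (Tm k) hQ
    have e := act_Tm k a b c
    generalize b + 2*a*k = b1 at *
    generalize a * k^2 + b * k + c = c1 at *
    rcases lt_trichotomy c1 a with h | h | h
    · have hQ3 := posdef_act Sm hQ2
      rw [e, act_Sm] at hQ3
      obtain ⟨γ, hγ⟩ := ih (c1, -b1, a) hQ3 (by have := hQ3.1; dsimp only at *; omega)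
      refine ⟨Tm k * Sm * γ, ?_⟩
      rw [formAct_mul, formAct_mul, e, act_Sm]; exact hγ
    · by_cases hb : 0 ≤ b1
      · refine ⟨Tm k, ?_⟩
        rw [e]; exact ⟨ha, hk1, hk2, h.ge, fun _ => hb⟩
      · refine ⟨Tm k * Sm, ?_⟩
        rw [formAct_mul, e, act_Sm]
        subst h
        exact ⟨ha, by dsimp only; omega, by dsimp only; omega, le_refl _, fun _ => by dsimp only; omega⟩
    · refine ⟨Tm k, ?_⟩
      rw [e]; exact ⟨ha, hk1, hk2, h.le, fun hh => absurd hh h.ne⟩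
end

section
open Matrix

abbrev Stab (Q : F3) := {γ : SLZ // formAct γ Q = Q}

lemma stab_card_conj {Q Q' : F3} {g : SLZ} (h : formAct g Q = Q') : Nat.card (Stab Q') = Nat.card (Stab Q) := by
  have h2 := formAct_inv h
  refine Nat.card_congr ⟨fun γ => ⟨g * γ.1 * g⁻¹, ?_⟩, fun γ => ⟨g⁻¹ * γ.1 * g, ?_⟩, ?_, ?_⟩
  · rw [formAct_mul, formAct_mul, h, γ.2, h2]
  · rw [formAct_mul, formAct_mul, h2, γ.2, h]
  · intro γ; ext1; simp [mul_assoc]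
  · intro γ; ext1; simp [mul_assoc]

def Um : SLZ := ⟨!![0, -1; 1, 1], by simp [Matrix.det_fin_two]⟩
def Vm : SLZ := ⟨!![-1, -1; 1, 0], by simp [Matrix.det_fin_two]⟩

lemma SLZ_ext {γ δ : SLZ} (h1 : γ.1 0 0 = δ.1 0 0) (h2 : γ.1 0 1 = δ.1 0 1)
    (h3 : γ.1 1 0 = δ.1 1 0) (h4 : γ.1 1 1 = δ.1 1 1) : γ = δ := by
  ext i j; fin_cases i <;> fin_cases j <;> assumption

lemma SLZ_eq_iff {γ δ : SLZ} : γ = δ ↔ γ.1 0 0 = δ.1 0 0 ∧ γ.1 0 1 = δ.1 0 1 ∧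
    γ.1 1 0 = δ.1 1 0 ∧ γ.1 1 1 = δ.1 1 1 := by
  constructor
  · rintro rfl; simp
  · rintro ⟨h1, h2, h3, h4⟩; exact SLZ_ext h1 h2 h3 h4

/-- weight of a reduced form -/
def wR (Q : F3) : ℚ := if Q.1 = Q.2.1 ∧ Q.1 = Q.2.2 then 1/3 else
  if Q.2.1 = 0 ∧ Q.1 = Q.2.2 then 1/2 else 1

lemma stab_card_of (Q : F3) (s : Finset SLZ) (h : ∀ γ, γ ∈ s ↔ formAct γ Q = Q) : Nat.card (Stab Q) = s.card := by
  rw [← Nat.card_eq_finsetCard s]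
  exact Nat.card_congr (Equiv.subtypeEquivRight fun γ => (h γ).symm)

lemma formAct_neg (γ : SLZ) (Q : F3) : formAct (-γ) Q = formAct γ Q := by
  rw [formAct_eq, formAct_eq]
  simp only [Matrix.SpecialLinearGroup.coe_neg, Matrix.neg_apply]
  unfold fa; ext <;> dsimp only <;> ring

lemma stab_iff {a b c : ℤ} (h : D0 (a, b, c)) (γ : SLZ) : formAct γ (a, b, c) = (a, b, c) ↔
    ((γ = 1 ∨ γ = -1) ∨ ((b = 0 ∧ a = c) ∧ (γ = Sm ∨ γ = -Sm)) ∨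
      ((a = b ∧ a = c) ∧ (γ = Um ∨ γ = -Um ∨ γ = Vm ∨ γ = -Vm))) := by
  constructor
  · intro e
    rw [formAct_eq] at e
    have := (red_main h h (det_SLZ γ) e le_rfl).2
    generalize hp : γ.1 0 0 = p at this
    generalize hq : γ.1 0 1 = q at this
    generalize hr : γ.1 1 0 = r at this
    generalize hs : γ.1 1 1 = s at this
    have key : ∀ δ : SLZ, p = δ.1 0 0 → q = δ.1 0 1 → r = δ.1 1 0 → s = δ.1 1 1 → γ = δ :=
      fun δ h1 h2 h3 h4 => SLZ_ext (hp.trans h1) (hq.trans h2) (hr.trans h3) (hs.trans h4)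
    clear hp hq hr hs e h
    rcases this with ⟨rfl, rfl, rfl, rfl | rfl⟩ | ⟨h0, h0', rfl, rfl, rfl, rfl | rfl⟩ |
      ⟨h0, h0', rfl, rfl, rfl, rfl | rfl⟩ | ⟨h0, h0', rfl, rfl, rfl, rfl | rfl⟩
    · exact Or.inl (Or.inl (key _ rfl rfl rfl rfl))
    · exact Or.inl (Or.inr (key _ rfl rfl rfl rfl))
    · exact Or.inr (Or.inl ⟨⟨h0, h0'⟩, Or.inl (key _ rfl rfl rfl rfl)⟩)
    · exact Or.inr (Or.inl ⟨⟨h0, h0'⟩, Or.inr (key _ rfl rfl rfl rfl)⟩)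
    · exact Or.inr (Or.inr ⟨⟨h0, h0'⟩, Or.inl (key _ rfl rfl rfl rfl)⟩)
    · exact Or.inr (Or.inr ⟨⟨h0, h0'⟩, Or.inr (Or.inl (key _ rfl rfl rfl rfl))⟩)
    · exact Or.inr (Or.inr ⟨⟨h0, h0'⟩, Or.inr (Or.inr (Or.inl (key _ rfl rfl rfl rfl)))⟩)
    · exact Or.inr (Or.inr ⟨⟨h0, h0'⟩, Or.inr (Or.inr (Or.inr (key _ rfl rfl rfl rfl)))⟩)
  · intro e
    rcases e with (rfl | rfl) | ⟨⟨rfl, rfl⟩, (rfl | rfl)⟩ | ⟨⟨rfl, rfl⟩, (rfl | rfl | rfl | rfl)⟩ <;>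
      (try simp only [formAct_neg]) <;> rw [formAct_eq] <;> simp [fa, Sm, Um, Vm] <;> ring_nf

lemma stab_wR {Q : F3} (h : D0 Q) : (2 : ℚ) / Nat.card (Stab Q) = wR Q := by
  obtain ⟨a, b, c⟩ := Q
  have ha : 0 < a := h.1
  unfold wR
  dsimp only
  split_ifs with h1 h2
  · rw [stab_card_of _ {1, -1, Um, -Um, Vm, -Vm}]
    · rw [show ({1, -1, Um, -Um, Vm, -Vm} : Finset SLZ).card = 6 by decide]; norm_num
    · intro γ; rw [stab_iff h]
      have : ¬ b = 0 := by omega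
      simp [h1, this]
      grind
  · rw [stab_card_of _ {1, -1, Sm, -Sm}]
    · rw [show ({1, -1, Sm, -Sm} : Finset SLZ).card = 4 by decide]; norm_num
    · intro γ; rw [stab_iff h]
      have : ¬ a = b := by omega
      simp [h2, this]
      grind
  · rw [stab_card_of _ {1, -1}]
    · rw [show ({1, -1} : Finset SLZ).card = 2 by decide]; norm_num
    · intro γ; rw [stab_iff h]
      simp [h1, h2]

/-- reduced forms of discriminant `-N` -/
noncomputable def RedF (N : ℤ) : Finset F3 :=
  (Finset.Icc 1 N ×ˢ Finset.Icc (-N) N ×ˢ Finset.Icc 1 N).filter (fun Q => D0 Q ∧ formDisc Q = -N)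

lemma mem_RedF {N : ℤ} (Q : F3) : Q ∈ RedF N ↔ D0 Q ∧ formDisc Q = -N := by
  unfold RedF
  rw [Finset.mem_filter]
  refine ⟨fun h => h.2, fun h => ⟨?_, h⟩⟩
  obtain ⟨a, b, c⟩ := Q
  obtain ⟨⟨h1, h2, h3, h4, -⟩, h5⟩ := h
  unfold formDisc at h5
  simp only [Finset.mem_product, Finset.mem_Icc]
  dsimp only at *
  have e1 : b^2 ≤ a^2 := by nlinarith
  have e2 : a^2 ≤ a*c := by nlinarith
  have e3 : a * 1 ≤ a*c := by nlinarith
  have e4 : c ≤ a*c := by nlinarith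
  refine ⟨⟨by omega, by linarith⟩, ⟨by linarith, by linarith⟩, by omega, by linarith⟩

lemma class_rel {N : ℤ} (Q Q' : {Q : ℤ × ℤ × ℤ // formDisc Q = -N ∧ IsPosDef Q})
    (h : (Quot.mk _ Q : FormClasses N) = Quot.mk _ Q') : ∃ γ : SLZ, formAct γ Q.1 = Q'.1 := by
  have hE : Equivalence (fun (Q Q' : {Q : ℤ × ℤ × ℤ // formDisc Q = -N ∧ IsPosDef Q}) =>
    ∃ γ : Matrix.SpecialLinearGroup (Fin 2) ℤ, formAct γ Q.1 = Q'.1) := by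
    refine ⟨fun Q => ⟨1, formAct_one _⟩, ?_, ?_⟩
    · rintro Q Q' ⟨γ, h⟩; exact ⟨γ⁻¹, formAct_inv h⟩
    · rintro Q Q' Q'' ⟨γ, h⟩ ⟨δ, h'⟩; exact ⟨γ * δ, by rw [formAct_mul, h, h']⟩
  exact hE.eqvGen_iff.1 (Quot.eqvGen_exact h)

lemma hurwitz_eq {N : ℤ} (hN : N ≠ 0) : hurwitzClassNumber N = ∑ Q ∈ RedF N, (wR Q : ℝ) := by
  unfold hurwitzClassNumber
  rw [if_neg hN]
  rw [← Finset.sum_coe_sort, ← finsum_eq_sum_of_fintype]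
  symm
  refine finsum_eq_of_bijective (fun Q : RedF N => (Quot.mk _ ⟨Q.1, ((mem_RedF _).1 Q.2).2, ((mem_RedF _).1 Q.2).1.posdef⟩ : FormClasses N)) ⟨?_, ?_⟩ ?_
  · rintro ⟨Q, hQ⟩ ⟨Q', hQ'⟩ h
    obtain ⟨γ, hγ⟩ := class_rel _ _ h
    ext1
    exact (red_unique ((mem_RedF _).1 hQ).1 ((mem_RedF _).1 hQ').1 hγ).symm
  · intro c
    induction c using Quot.ind with
    | mk Q =>
    obtain ⟨Q, hd, hp⟩ := Q
    obtain ⟨γ, hγ⟩ := exists_red _ Q hp le_rfl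
    refine ⟨⟨formAct γ Q, (mem_RedF _).2 ⟨hγ, by rw [formDisc_act, hd]⟩⟩, ?_⟩
    apply Quot.sound
    exact ⟨γ⁻¹, formAct_inv rfl⟩
  · rintro ⟨Q, hQ⟩
    dsimp only
    rw [← stab_wR ((mem_RedF _).1 hQ).1]
    push_cast
    congr 2
    generalize hc : (Quot.mk _ ⟨Q, _⟩ : FormClasses N) = c
    obtain ⟨γ, hγ⟩ := class_rel _ _ (hc.trans (Quot.out_eq c).symm)
    exact (stab_card_conj hγ).symm

lemma hurwitz_neg {N : ℤ} (hN : N < 0) : hurwitzClassNumber N = 0 := by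
  rw [hurwitz_eq hN.ne]
  refine Finset.sum_eq_zero fun Q hQ => ?_
  have := (mem_RedF _).1 hQ
  have h2 := this.1.posdef.2
  omega
end

section
open Matrix ENNReal

lemma wR_pos (Q : F3) : 0 < wR Q := by unfold wR; split_ifs <;> norm_num

/-- weight, supported on reduced forms -/
noncomputable def W (Q : F3) : ℝ≥0∞ := if D0 Q then ENNReal.ofReal (wR Q : ℝ) else 0

lemma W_sum {Q : F3} (hQ : IsPosDef Q) : ∑' γ : SLZ, W (formAct γ Q) = 2 := by
  obtain ⟨g, hg⟩ := exists_red _ Q hQ le_rfl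
  rw [← (Equiv.mulLeft g).tsum_eq]
  simp only [Equiv.coe_mulLeft, formAct_mul]
  generalize formAct g Q = Q0 at hg
  have h1 : ∀ δ : SLZ, W (formAct δ Q0) = Set.indicator {δ : SLZ | formAct δ Q0 = Q0} (fun _ => W Q0) δ := by
    intro δ
    by_cases h : formAct δ Q0 = Q0
    · rw [Set.indicator_of_mem (by exact h), h]
    · rw [Set.indicator_of_notMem (by exact h)]
      unfold W; rw [if_neg]
      intro hD; exact h (red_unique hg hD rfl)
  simp_rw [h1]
  rw [← tsum_subtype, ENNReal.tsum_const]
  have hc := stab_wR hg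
  have hne : Nat.card (Stab Q0) ≠ 0 := by
    intro h0; rw [h0] at hc; simp at hc; exact (wR_pos Q0).ne hc
  have hfin : Finite (Stab Q0) := Nat.finite_of_card_ne_zero hne
  have e1 : ENat.card {δ : SLZ | formAct δ Q0 = Q0} = (Nat.card (Stab Q0) : ℕ∞) :=
    ENat.card_eq_coe_natCard (Stab Q0)
  rw [e1]
  unfold W; rw [if_pos hg, ← hc]
  have : ((Nat.card (Stab Q0) : ℕ∞) : ℝ≥0∞) = ENNReal.ofReal (Nat.card (Stab Q0) : ℝ) := by
    simp
  rw [this, ← ENNReal.ofReal_mul (by positivity)]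
  push_cast
  rw [mul_div_cancel₀]
  · simp
  · exact_mod_cast hne

/-- integral matrices of determinant three -/
abbrev Mat3 := {A : ℤ × ℤ × ℤ × ℤ // A.1 * A.2.2.2 - A.2.1 * A.2.2.1 = 3}

def mact (A : ℤ × ℤ × ℤ × ℤ) (Q : F3) : F3 := fa A.1 A.2.1 A.2.2.1 A.2.2.2 Q

def cos3 (i : Fin 4) : ℤ × ℤ × ℤ × ℤ := ![(1, 0, 0, 3), (1, 0, 1, 3), (1, 0, 2, 3), (3, 0, 0, 1)] i

def mul4 (A : ℤ × ℤ × ℤ × ℤ) (γ : SLZ) : ℤ × ℤ × ℤ × ℤ :=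
  (A.1 * γ.1 0 0 + A.2.1 * γ.1 1 0, A.1 * γ.1 0 1 + A.2.1 * γ.1 1 1,
   A.2.2.1 * γ.1 0 0 + A.2.2.2 * γ.1 1 0, A.2.2.1 * γ.1 0 1 + A.2.2.2 * γ.1 1 1)

lemma mact_mul4 (A : ℤ × ℤ × ℤ × ℤ) (γ : SLZ) (Q : F3) : mact (mul4 A γ) Q = formAct γ (mact A Q) := by
  rw [formAct_eq]; unfold mact mul4; rw [fa_comp]

lemma det_mul4 (A : ℤ × ℤ × ℤ × ℤ) (γ : SLZ) : (mul4 A γ).1 * (mul4 A γ).2.2.2 - (mul4 A γ).2.1 * (mul4 A γ).2.2.1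
   = A.1 * A.2.2.2 - A.2.1 * A.2.2.1 := by
  have := det_SLZ γ
  unfold mul4; dsimp only
  linear_combination (A.1 * A.2.2.2 - A.2.1 * A.2.2.1) * this

lemma det_cos3 (i : Fin 4) : (cos3 i).1 * (cos3 i).2.2.2 - (cos3 i).2.1 * (cos3 i).2.2.1 = 3 := by
  fin_cases i <;> simp [cos3]

def mk3 (x : Fin 4 × SLZ) : Mat3 := ⟨mul4 (cos3 x.1) x.2, by rw [det_mul4, det_cos3]⟩

lemma no3 {p q r s : ℤ} (h : p * s - q * r = 1) (hp : (3:ℤ) ∣ p) (hq : (3:ℤ) ∣ q) : False := by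
  obtain ⟨u, rfl⟩ := hp
  obtain ⟨v, rfl⟩ := hq
  have : 3 * (u * s - v * r) = 1 := by linarith
  omega

lemma mk3_inj : Function.Injective mk3 := by
  rintro ⟨i, γ⟩ ⟨i', γ'⟩ h
  have h0 := det_SLZ γ
  have h0' := det_SLZ γ'
  simp only [mk3, mul4, Subtype.mk.injEq, Prod.mk.injEq] at h
  obtain ⟨h1, h2, h3, h4⟩ := h
  have key : i = i' ∧ γ = γ' := by
    rw [SLZ_eq_iff]
    generalize γ.1 0 0 = p at *
    generalize γ.1 0 1 = q at *
    generalize γ.1 1 0 = r at *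
    generalize γ.1 1 1 = s at *
    generalize γ'.1 0 0 = p' at *
    generalize γ'.1 0 1 = q' at *
    generalize γ'.1 1 0 = r' at *
    generalize γ'.1 1 1 = s' at *
    fin_cases i <;> fin_cases i' <;> simp [cos3] at h1 h2 h3 h4 ⊢
    all_goals first
      | (refine ⟨?_, ?_, ?_, ?_⟩ <;> omega)
      | exact no3 h0 (by omega) (by omega)
      | exact no3 h0' (by omega) (by omega)
  rw [key.1, key.2]

lemma res3 : ∀ p q r s : ZMod 3, p * s - q * r = 0 → ¬ (p = 0 ∧ q = 0) →
    (r = 0 ∧ s = 0) ∨ (r = p ∧ s = q) ∨ (r = 2 * p ∧ s = 2 * q) := by decide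

lemma dvd3 (x : ℤ) : (3:ℤ) ∣ x ↔ (x : ZMod 3) = 0 := (ZMod.intCast_zmod_eq_zero_iff_dvd x 3).symm

lemma mk3_surj : Function.Surjective mk3 := by
  rintro ⟨⟨p, q, r, s⟩, h⟩
  dsimp only at h
  have hz : (p : ZMod 3) * s - q * r = 0 := by
    have := congrArg (Int.cast : ℤ → ZMod 3) h
    push_cast at this; rw [this]; rfl
  have fin : ∀ i : Fin 4, ∀ p1 q1 r1 s1 : ℤ, ∀ hd : p1 * s1 - q1 * r1 = 1,
      (p, q, r, s) = mul4 (cos3 i) ⟨!![p1, q1; r1, s1], by rw [Matrix.det_fin_two]; exact hd⟩ →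
      ∃ a, mk3 a = ⟨(p, q, r, s), h⟩ := by
    intro i p1 q1 r1 s1 hd e
    exact ⟨(i, ⟨!![p1, q1; r1, s1], by rw [Matrix.det_fin_two]; exact hd⟩), Subtype.ext e.symm⟩
  by_cases h0 : (p : ZMod 3) = 0 ∧ (q : ZMod 3) = 0
  · rw [← dvd3, ← dvd3] at h0
    obtain ⟨⟨u, rfl⟩, ⟨v, rfl⟩⟩ := h0
    exact fin 3 u v r s (by linarith) (by simp [mul4, cos3])
  · rcases res3 _ _ _ _ hz h0 with ⟨h1, h2⟩ | ⟨h1, h2⟩ | ⟨h1, h2⟩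
    · rw [← dvd3] at h1 h2
      obtain ⟨⟨u, rfl⟩, ⟨v, rfl⟩⟩ := And.intro h1 h2
      exact fin 0 p q u v (by linarith) (by simp [mul4, cos3])
    · have h1' : (3:ℤ) ∣ r - p := by rw [dvd3]; push_cast; rw [h1]; ring
      have h2' : (3:ℤ) ∣ s - q := by rw [dvd3]; push_cast; rw [h2]; ring
      obtain ⟨u, hu⟩ := h1'
      obtain ⟨v, hv⟩ := h2'
      obtain rfl : r = p + 3 * u := by linarith
      obtain rfl : s = q + 3 * v := by linarith
      exact fin 1 p q u v (by linarith) (by simp [mul4, cos3])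
    · have h1' : (3:ℤ) ∣ r - 2 * p := by rw [dvd3]; push_cast; rw [h1]; ring
      have h2' : (3:ℤ) ∣ s - 2 * q := by rw [dvd3]; push_cast; rw [h2]; ring
      obtain ⟨u, hu⟩ := h1'
      obtain ⟨v, hv⟩ := h2'
      obtain rfl : r = 2 * p + 3 * u := by linarith
      obtain rfl : s = 2 * q + 3 * v := by linarith
      exact fin 2 p q u v (by linarith) (by simp [mul4, cos3])

lemma tsum_Mat3 (f : Mat3 → ℝ≥0∞) : ∑' A : Mat3, f A = ∑ i : Fin 4, ∑' γ : SLZ, f (mk3 (i, γ)) := by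
  rw [← (Equiv.ofBijective mk3 ⟨mk3_inj, mk3_surj⟩).tsum_eq]
  rw [ENNReal.tsum_prod', tsum_fintype]
  rfl
end

section
open Matrix ENNReal

noncomputable def XW (N : ℤ) (Q : F3) : ℝ≥0∞ := if formDisc Q = -N then W Q else 0
noncomputable def HE (N : ℤ) : ℝ≥0∞ := ∑' Q : F3, XW N Q

lemma HE_eq {N : ℤ} (hN : N ≠ 0) : HE N = ENNReal.ofReal (hurwitzClassNumber N) := by
  unfold HE
  rw [tsum_eq_sum (s := RedF N), hurwitz_eq hN, ENNReal.ofReal_sum_of_nonneg]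
  · refine Finset.sum_congr rfl fun Q hQ => ?_
    rw [mem_RedF] at hQ
    rw [XW, if_pos hQ.2, W, if_pos hQ.1]
  · intro Q _; exact_mod_cast (wR_pos Q).le
  · intro Q hQ
    rw [mem_RedF] at hQ
    unfold XW W
    split_ifs with h1 h2
    · exact absurd ⟨h2, h1⟩ hQ
    · rfl
    · rfl

lemma XW_ne {N : ℤ} {Q : F3} (h : XW N Q ≠ 0) : formDisc Q = -N ∧ D0 Q := by
  unfold XW W at h
  split_ifs at h with h1 h2
  · exact ⟨h1, h2⟩
  · simp at h
  · simp at h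

lemma S1 (N : ℤ) : ∑' p : F3 × Mat3, XW N p.1 * W (mact p.2.1 p.1) = 8 * HE N := by
  rw [ENNReal.tsum_prod', HE, ← ENNReal.tsum_mul_left]
  refine tsum_congr fun Q => ?_
  by_cases h : XW N Q = 0
  · simp [h]
  · have hp := (XW_ne h).2.posdef
    dsimp only
    rw [ENNReal.tsum_mul_left, tsum_Mat3]
    have : ∀ i : Fin 4, ∑' γ : SLZ, W (mact (mk3 (i, γ)).1 Q) = 2 := by
      intro i
      simp only [mk3, mact_mul4]
      exact W_sum (posdef_fa (by rw [det_cos3]; norm_num) hp)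
    simp only [this]
    simp
    rw [mul_comm]; norm_num

def dv9 (Q : F3) : Prop := (9:ℤ) ∣ Q.1 ∧ (9:ℤ) ∣ Q.2.1 ∧ (9:ℤ) ∣ Q.2.2
instance (Q : F3) : Decidable (dv9 Q) := by unfold dv9; infer_instance
def q9 (Q : F3) : F3 := (Q.1 / 9, Q.2.1 / 9, Q.2.2 / 9)
def sc (k : ℤ) (Q : F3) : F3 := (k * Q.1, k * Q.2.1, k * Q.2.2)

lemma dv9_sc (Q : F3) : dv9 (sc 9 Q) := ⟨dvd_mul_right _ _, dvd_mul_right _ _, dvd_mul_right _ _⟩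
lemma q9_sc (Q : F3) : q9 (sc 9 Q) = Q := by
  obtain ⟨a, b, c⟩ := Q
  simp [q9, sc]
lemma sc_q9 {Q : F3} (h : dv9 Q) : sc 9 (q9 Q) = Q := by
  obtain ⟨a, b, c⟩ := Q
  obtain ⟨h1, h2, h3⟩ := h
  dsimp only at *
  simp only [q9, sc, Int.mul_ediv_cancel' h1, Int.mul_ediv_cancel' h2, Int.mul_ediv_cancel' h3]
lemma fa_sc (p q r s k : ℤ) (Q : F3) : fa p q r s (sc k Q) = sc k (fa p q r s Q) := by
  unfold fa sc; ext <;> dsimp only <;> ring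
lemma mact_sc (A : ℤ × ℤ × ℤ × ℤ) (k : ℤ) (Q : F3) : mact A (sc k Q) = sc k (mact A Q) := fa_sc _ _ _ _ _ _
lemma formAct_sc (γ : SLZ) (k : ℤ) (Q : F3) : formAct γ (sc k Q) = sc k (formAct γ Q) := by
  rw [formAct_eq, formAct_eq, fa_sc]
lemma sc_inj {k : ℤ} (hk : k ≠ 0) : Function.Injective (sc k) := by
  rintro ⟨a, b, c⟩ ⟨a', b', c'⟩ h
  simp only [sc, Prod.mk.injEq, mul_right_inj' hk] at h
  simp [h]
lemma formDisc_sc (k : ℤ) (Q : F3) : formDisc (sc k Q) = k ^ 2 * formDisc Q := by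
  unfold formDisc sc; dsimp only; ring

def adj (A : Mat3) : Mat3 := ⟨(A.1.2.2.2, -A.1.2.1, -A.1.2.2.1, A.1.1), by
  have := A.2; dsimp only; linarith⟩
lemma adj_adj (A : Mat3) : adj (adj A) = A := by
  apply Subtype.ext; simp [adj]
lemma mact_adj (A : Mat3) (Q : F3) : mact (adj A).1 (mact A.1 Q) = sc 9 Q := by
  obtain ⟨⟨p, q, r, s⟩, h⟩ := A
  obtain ⟨a, b, c⟩ := Q
  dsimp only at h
  have h2 : (p * s - q * r)^2 = 9 := by rw [h]; norm_num
  simp only [mact, adj, fa, sc, Prod.mk.injEq]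
  refine ⟨?_, ?_, ?_⟩
  · linear_combination a * h2
  · linear_combination b * h2
  · linear_combination c * h2
lemma mact_adj2 (A : Mat3) (Q : F3) : mact A.1 (mact (adj A).1 Q) = sc 9 Q := by
  conv_lhs => rw [← adj_adj A]
  rw [adj_adj]
  have := mact_adj (adj A) Q
  rwa [adj_adj] at this
lemma formDisc_mact (A : Mat3) (Q : F3) : formDisc (mact A.1 Q) = 9 * formDisc Q := by
  rw [mact, formDisc_fa, A.2]; norm_num

noncomputable def GG (N : ℤ) (p : F3 × Mat3) : ℝ≥0∞ :=
  if dv9 (mact p.2.1 p.1) then XW (9 * N) p.1 * W (q9 (mact p.2.1 p.1)) else 0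

lemma S2 (N : ℤ) : ∑' p : F3 × Mat3, GG N p = 8 * HE N := by
  rw [← S1]
  have hinj : Function.Injective (fun p : F3 × Mat3 => ((mact p.2.1 p.1, adj p.2) : F3 × Mat3)) := by
    rintro ⟨Q, A⟩ ⟨Q', A'⟩ h
    simp only [Prod.mk.injEq] at h
    obtain ⟨h1, h2⟩ := h
    have h3 : A = A' := by rw [← adj_adj A, h2, adj_adj]
    subst h3
    have h4 : sc 9 Q = sc 9 Q' := by rw [← mact_adj A, h1, mact_adj]
    rw [sc_inj (by norm_num) h4]
  rw [← hinj.tsum_eq]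
  · refine tsum_congr ?_
    rintro ⟨Q, A⟩
    simp only [GG, mact_adj, q9_sc]
    rw [if_pos (dv9_sc _), XW, XW, formDisc_mact]
    by_cases h : formDisc Q = -N
    · rw [if_pos h, if_pos (by rw [h]; ring), mul_comm]
    · rw [if_neg h, if_neg (by omega)]; simp
  · rintro ⟨Q, A⟩ h
    have hd : dv9 (mact A.1 Q) := by
      by_contra hd
      simp [GG, hd] at h
    refine ⟨(q9 (mact A.1 Q), adj A), ?_⟩
    simp only [adj_adj, Prod.mk.injEq, and_true]
    apply sc_inj (k := 9) (by norm_num)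
    rw [← mact_sc, sc_q9 hd, mact_adj]

lemma dv9_act (γ : SLZ) (Q : F3) : dv9 (formAct γ Q) ↔ dv9 Q := by
  have key : ∀ (γ : SLZ) (Q : F3), dv9 Q → dv9 (formAct γ Q) := by
    intro γ Q h
    rw [← sc_q9 h, formAct_sc]; exact dv9_sc _
  refine ⟨fun h => ?_, key γ Q⟩
  have := key γ⁻¹ _ h
  rwa [formAct_inv rfl] at this

def nu (Q : F3) : ℕ := ∑ i : Fin 4, if dv9 (mact (cos3 i) Q) then 1 else 0

lemma posdef_of_sc {Q : F3} (h : IsPosDef (sc 9 Q)) : IsPosDef Q := by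
  obtain ⟨h1, h2⟩ := h
  rw [formDisc_sc] at h2
  refine ⟨?_, by linarith⟩
  simp only [sc] at h1
  linarith

lemma S3 (N : ℤ) : ∑' p : F3 × Mat3, GG N p = 2 * ∑' Q, XW (9 * N) Q * nu Q := by
  rw [ENNReal.tsum_prod', ← ENNReal.tsum_mul_left]
  refine tsum_congr fun Q => ?_
  by_cases h : XW (9 * N) Q = 0
  · simp [GG, h]
  have hp := (XW_ne h).2.posdef
  rw [tsum_Mat3]
  have : ∀ i : Fin 4, ∑' γ : SLZ, GG N (Q, mk3 (i, γ)) =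
      2 * XW (9*N) Q * ((if dv9 (mact (cos3 i) Q) then 1 else 0 : ℕ) : ℝ≥0∞) := by
    intro i
    simp only [GG, mk3, mact_mul4, dv9_act]
    split_ifs with hd
    · have e : ∀ γ : SLZ, q9 (formAct γ (mact (cos3 i) Q)) = formAct γ (q9 (mact (cos3 i) Q)) := by
        intro γ
        conv_lhs => rw [← sc_q9 hd, formAct_sc, q9_sc]
      simp only [e]
      rw [ENNReal.tsum_mul_left, W_sum]
      · simp [mul_comm]
      · apply posdef_of_sc; rw [sc_q9 hd]
        exact posdef_fa (by rw [det_cos3]; norm_num) hp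
    · simp
  simp only [this]
  rw [← Finset.mul_sum, nu]; push_cast; rw [mul_assoc]

lemma S4 (N : ℤ) : ∑' Q, XW (9 * N) Q * nu Q = 4 * HE N := by
  have := (S3 N).symm.trans (S2 N)
  have h8 : (8 : ℝ≥0∞) * HE N = 2 * (4 * HE N) := by rw [← mul_assoc]; norm_num
  rw [h8] at this
  exact (ENNReal.mul_right_inj (by norm_num) (by norm_num)).1 this

def dv3 (Q : F3) : Prop := (3:ℤ) ∣ Q.1 ∧ (3:ℤ) ∣ Q.2.1 ∧ (3:ℤ) ∣ Q.2.2
instance (Q : F3) : Decidable (dv3 Q) := by unfold dv3; infer_instance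
lemma dv3_iff (Q : F3) : dv3 Q ↔ Q ∈ Set.range (sc 3) := by
  obtain ⟨a, b, c⟩ := Q
  constructor
  · rintro ⟨⟨x, hx⟩, ⟨y, hy⟩, ⟨z, hz⟩⟩
    exact ⟨(x, y, z), by dsimp only at *; simp [sc, hx, hy, hz]⟩
  · rintro ⟨⟨x, y, z⟩, h⟩
    rw [← h]; exact ⟨dvd_mul_right _ _, dvd_mul_right _ _, dvd_mul_right _ _⟩

lemma z9 : ∀ a b c : ZMod 9, b * b - 4 * a * c = 0 → ¬ (3 * a = 0 ∧ 3 * b = 0 ∧ 3 * c = 0) →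
    (if a = 0 ∧ 3 * b = 0 then 1 else 0) + (if a + b + c = 0 ∧ 3 * b + 6 * c = 0 then 1 else 0)
    + (if a + 2 * b + 4 * c = 0 ∧ 3 * b + 12 * c = 0 then 1 else 0) +
    (if 3 * b = 0 ∧ c = 0 then 1 else 0) = 1 := by decide +kernel

lemma z3 : ∀ a b c : ZMod 3,  
    (if a = 0 then 1 else 0) + (if a + b + c = 0 then 1 else 0)
    + (if a + 2 * b + 4 * c = 0 then 1 else 0) + (if c = 0 then 1 else 0) = 
     if b * b - 4 * a * c = 1 then 2 else if b * b - 4 * a * c = 0 then 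
      (if a = 0 ∧ b = 0 ∧ c = 0 then 4 else 1) else 0 := by decide +kernel

lemma dvd9 (x : ℤ) : (9:ℤ) ∣ x ↔ (x : ZMod 9) = 0 := (ZMod.intCast_zmod_eq_zero_iff_dvd x 9).symm

lemma ifc {P Q : Prop} [Decidable P] [Decidable Q] (h : P ↔ Q) : (if P then 1 else 0 : ℕ) = if Q then 1 else 0 := by
  simp [h]

lemma nu_one {Q : F3} {N : ℤ} (h : formDisc Q = -(9 * N)) (h3 : ¬ dv3 Q) : nu Q = 1 := by
  obtain ⟨a, b, c⟩ := Q
  have e := z9 a b c ?_ ?_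
  · rw [← e, nu, Fin.sum_univ_four]
    simp only [dv9, mact, cos3, fa, dvd9]
    have n9 : (9 : ZMod 9) = 0 := rfl
    congr 1; congr 1; congr 1
    all_goals
      refine ifc ?_
      simp [n9]
      try ring_nf
      try simp [n9]
  · unfold formDisc at h
    have := congrArg (Int.cast : ℤ → ZMod 9) h
    push_cast at this
    have n9 : (9 : ZMod 9) = 0 := rfl
    rw [n9] at this
    linear_combination this
  · intro hh
    apply h3
    have t : ∀ x : ℤ, 3 * (x : ZMod 9) = 0 → (3:ℤ) ∣ x := by
      intro x hx
      have : ((3 * x : ℤ) : ZMod 9) = 0 := by push_cast; exact hx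
      rw [← dvd9] at this; omega
    exact ⟨t _ hh.1, t _ hh.2.1, t _ hh.2.2⟩

lemma nu_three (Q : F3) : nu (sc 3 Q) = 
     if (3:ℤ) ∣ formDisc Q - 1 then 2 else if (3:ℤ) ∣ formDisc Q then (if dv3 Q then 4 else 1) else 0 := by
  obtain ⟨a, b, c⟩ := Q
  have e := z3 a b c
  have hd : ((formDisc (a, b, c) : ℤ) : ZMod 3) = b * b - 4 * a * c := by
    unfold formDisc; push_cast; ring
  have h1 : (3:ℤ) ∣ formDisc (a, b, c) - 1 ↔ (b * b - 4 * a * c : ZMod 3) = 1 := by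
    rw [dvd3]; push_cast; rw [hd, sub_eq_zero]
  have h2 : (3:ℤ) ∣ formDisc (a, b, c) ↔ (b * b - 4 * a * c : ZMod 3) = 0 := by
    rw [dvd3, hd]
  have h3 : dv3 (a, b, c) ↔ ((a : ZMod 3) = 0 ∧ (b : ZMod 3) = 0 ∧ (c : ZMod 3) = 0) := by
    unfold dv3; rw [dvd3, dvd3, dvd3]
  simp only [h1, h2, h3]
  rw [← e, nu, Fin.sum_univ_four]
  have r1 : ((a : ZMod 3) + b + c = 0) ↔ (3:ℤ) ∣ a + b + c := by rw [dvd3]; push_cast; rfl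
  have r2 : ((a : ZMod 3) + 2 * b + 4 * c = 0) ↔ (3:ℤ) ∣ a + 2 * b + 4 * c := by rw [dvd3]; push_cast; rfl
  simp only [r1, r2, ← dvd3]
  simp only [sc, dv9, mact, cos3, fa]
  congr 1; congr 1; congr 1
  all_goals
    refine ifc ?_
    simp
    omega

lemma XW_sc3 (N : ℤ) (Q : F3) : XW (9 * N) (sc 3 Q) = XW N Q := by
  unfold XW
  rw [formDisc_sc]
  have e : W (sc 3 Q) = W Q := by
    obtain ⟨a, b, c⟩ := Q
    have h1 : D0 (sc 3 (a, b, c)) ↔ D0 (a, b, c) := by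
      unfold D0 sc; dsimp only; omega
    have h2 : wR (sc 3 (a, b, c)) = wR (a, b, c) := by
      unfold wR sc; dsimp only
      simp
    unfold W; simp only [h1, h2]
  by_cases h : formDisc Q = -N
  · rw [if_pos h, if_pos (by rw [h]; ring), e]
  · rw [if_neg h, if_neg (by omega)]

lemma tsum_sc3 (f : F3 → ℝ≥0∞) : ∑' Q, (if dv3 Q then f Q else 0) = ∑' Q, f (sc 3 Q) := by
  rw [← (sc_inj (k := 3) (by norm_num)).tsum_eq]
  · refine tsum_congr fun Q => ?_
    rw [if_pos]; rw [dv3_iff]; exact ⟨Q, rfl⟩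
  · intro Q h
    rw [← dv3_iff]
    by_contra hd
    simp [hd] at h

lemma S5 (N : ℤ) : 4 * HE N + HE N = HE (9 * N) + ∑' Q, XW N Q * nu (sc 3 Q) := by
  have e1 : ∑' Q, XW (9 * N) Q * nu Q = ∑' Q, (if dv3 Q then XW (9 * N) Q * nu Q else 0)
      + ∑' Q, (if dv3 Q then 0 else XW (9 * N) Q) := by
    rw [← ENNReal.tsum_add]
    refine tsum_congr fun Q => ?_
    split_ifs with h
    · simp
    · by_cases h0 : XW (9 * N) Q = 0
      · simp [h0]
      · rw [nu_one (XW_ne h0).1 h]; simp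
  have e2 : HE (9 * N) = ∑' Q, (if dv3 Q then XW (9 * N) Q else 0)
      + ∑' Q, (if dv3 Q then 0 else XW (9 * N) Q) := by
    rw [← ENNReal.tsum_add, HE]
    refine tsum_congr fun Q => ?_
    split_ifs with h <;> simp
  rw [tsum_sc3] at e1 e2
  simp only [XW_sc3] at e1 e2
  rw [← S4, e1, e2, HE]; ring

lemma HE_ne_top {N : ℤ} (hN : N ≠ 0) : HE N ≠ ⊤ := by rw [HE_eq hN]; exact ENNReal.ofReal_ne_top

lemma H_nonneg {N : ℤ} (hN : N ≠ 0) : 0 ≤ hurwitzClassNumber N := by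
  rw [hurwitz_eq hN]; exact Finset.sum_nonneg fun Q _ => by exact_mod_cast (wR_pos Q).le

lemma HE_toReal {N : ℤ} (hN : N ≠ 0) : (HE N).toReal = hurwitzClassNumber N := by
  rw [HE_eq hN, ENNReal.toReal_ofReal (H_nonneg hN)]

lemma hecke_two {N : ℤ} (h : (3:ℤ) ∣ -N - 1) : hurwitzClassNumber (9 * N) = 3 * hurwitzClassNumber N := by
  have hN : N ≠ 0 := by omega
  have h9 : 9 * N ≠ 0 := by omega
  have := S5 N
  have e : ∑' Q, XW N Q * nu (sc 3 Q) = 2 * HE N := by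
    rw [HE, ← ENNReal.tsum_mul_left]
    refine tsum_congr fun Q => ?_
    by_cases h0 : XW N Q = 0
    · simp [h0]
    · rw [nu_three, if_pos (by rw [(XW_ne h0).1]; exact h), mul_comm]; rfl
  rw [e] at this
  have := congrArg ENNReal.toReal this
  rw [ENNReal.toReal_add (ENNReal.mul_ne_top (by norm_num) (HE_ne_top hN)) (HE_ne_top hN),
    ENNReal.toReal_add (HE_ne_top h9) (ENNReal.mul_ne_top (by norm_num) (HE_ne_top hN)),
    ENNReal.toReal_mul, ENNReal.toReal_mul, HE_toReal hN, HE_toReal h9] at this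
  norm_num at this
  linarith

lemma S6 {N : ℤ} (h : (3:ℤ) ∣ N) : ∑' Q, XW N Q * nu (sc 3 Q) = HE N +
    3 * ∑' Q, (if dv3 Q then XW N Q else 0) := by
  rw [HE, ← ENNReal.tsum_mul_left, ← ENNReal.tsum_add]
  refine tsum_congr fun Q => ?_
  by_cases h0 : XW N Q = 0
  · simp [h0]
  · rw [nu_three, (XW_ne h0).1, if_neg (by omega), if_pos (by omega)]
    split_ifs
    · push_cast; ring
    · simp

lemma hecke_zero {N : ℤ} (h : (3:ℤ) ∣ N) (h9 : ¬ (9:ℤ) ∣ N) :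
    hurwitzClassNumber (9 * N) = 4 * hurwitzClassNumber N := by
  have hN : N ≠ 0 := by omega
  have hN9 : 9 * N ≠ 0 := by omega
  have := S5 N
  have e : ∑' Q, (if dv3 Q then XW N Q else 0) = 0 := by
    rw [tsum_sc3, ENNReal.tsum_eq_zero]
    intro Q
    by_contra h0
    have := (XW_ne h0).1
    rw [formDisc_sc] at this
    omega
  rw [S6 h, e, mul_zero, add_zero] at this
  have := congrArg ENNReal.toReal this
  rw [ENNReal.toReal_add (ENNReal.mul_ne_top (by norm_num) (HE_ne_top hN)) (HE_ne_top hN),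
    ENNReal.toReal_add (HE_ne_top hN9) (HE_ne_top hN),
    ENNReal.toReal_mul, HE_toReal hN, HE_toReal hN9] at this
  norm_num at this
  linarith

lemma hecke_nine (N : ℤ) :
    hurwitzClassNumber (9 * (9 * N)) = 4 * hurwitzClassNumber (9 * N) - 3 * hurwitzClassNumber N := by
  by_cases hN : N = 0
  · subst hN; simp; ring
  have hN1 : 9 * N ≠ 0 := by omega
  have hN9 : 9 * (9 * N) ≠ 0 := by omega
  have := S5 (9 * N)
  have e : ∑' Q, (if dv3 Q then XW (9 * N) Q else 0) = HE N := by
    rw [tsum_sc3, HE]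
    exact tsum_congr fun Q => XW_sc3 N Q
  rw [S6 (by omega), e] at this
  have t3 : 3 * HE N ≠ ⊤ := ENNReal.mul_ne_top (by norm_num) (HE_ne_top hN)
  have := congrArg ENNReal.toReal this
  rw [ENNReal.toReal_add (ENNReal.mul_ne_top (by norm_num) (HE_ne_top hN1)) (HE_ne_top hN1),
    ENNReal.toReal_add (HE_ne_top hN9) (ENNReal.add_ne_top.2 ⟨HE_ne_top hN1, t3⟩),
    ENNReal.toReal_add (HE_ne_top hN1) t3,
    ENNReal.toReal_mul, ENNReal.toReal_mul, HE_toReal hN, HE_toReal hN9, HE_toReal hN1] at this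
  norm_num at this
  linarith
end

section
open Finset
set_option linter.all false

def vw (x y a c : ℤ) : ℚ := if D0 (a, x - y, c) then wR (a, x - y, c) else 0

def vb (b a c : ℤ) : ℚ := if D0 (a, b, c) then wR (a, b, c) else 0

lemma sgv (z : ℤ) : sg z = if 0 < z then 1 else if z < 0 then -1 else 0 := by
  split_ifs with h1 h2
  · exact sg_pos h1
  · exact sg_neg h2
  · exact sg_zero (by omega)

lemma vb_lt {b a c : ℤ} (ha : 0 < a) (h : a < c) : vb b a c = if -a < b ∧ b ≤ a then 1 else 0 := by
  simp only [vb, D0, wR]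
  split_ifs <;> first | rfl | (exfalso; omega)
lemma vb_gt {b a c : ℤ} (h : c < a) : vb b a c = 0 := by
  simp only [vb, D0, wR]
  split_ifs <;> first | rfl | (exfalso; omega)
lemma vb_eq {b a : ℤ} (ha : 0 < a) : vb b a a = if b = 0 then 1/2 else if b = a then 1/3 else
    if 0 < b ∧ b < a then 1 else 0 := by
  simp only [vb, D0, wR, le_refl, true_and, forall_true_left, and_true]
  split_ifs <;> first | rfl | (exfalso; omega)

def wb (b a c : ℤ) : ℚ := if -min a c < b ∧ b < min a c then 1 else
  if b = min a c ∨ b = -min a c then (if a = c then 1/3 else 1/2) else 0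

lemma wI_wb {x y a c : ℤ} (ha : 0 < a) (hc : 0 < c) : wI x y a c = wb (x - y) a c := by
  unfold wI wb
  rw [show a - x + y = a - (x - y) by ring, show a + x - y = a + (x - y) by ring,
    show c - x + y = c - (x - y) by ring, show c + x - y = c + (x - y) by ring]
  generalize x - y = b
  rcases sg_cases (a - b) with ⟨h1, e1⟩ | ⟨h1, e1⟩ | ⟨h1, e1⟩ <;>
  rcases sg_cases (a + b) with ⟨h2, e2⟩ | ⟨h2, e2⟩ | ⟨h2, e2⟩ <;>
  rcases sg_cases (c - b) with ⟨h3, e3⟩ | ⟨h3, e3⟩ | ⟨h3, e3⟩ <;>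
  rcases sg_cases (c + b) with ⟨h4, e4⟩ | ⟨h4, e4⟩ | ⟨h4, e4⟩ <;>
  rcases sg_cases (a - c) with ⟨h5, e5⟩ | ⟨h5, e5⟩ | ⟨h5, e5⟩ <;>
  first
    | (exfalso; omega)
    | (rw [e1, e2, e3, e4, e5]
       split_ifs <;> first | (exfalso; omega) | norm_num)

lemma vb_sym_lt {b a c : ℤ} (ha : 0 < a) (h : a < c) : vb b a c + vb (-b) a c + vb b c a + vb (-b) c a = 2 * wb b a c := by
  rw [vb_lt ha h, vb_lt ha h, vb_gt h, vb_gt h]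
  unfold wb
  rw [min_eq_left h.le]
  split_ifs <;> first | (exfalso; omega) | norm_num

lemma vb_sym_eq {b a : ℤ} (ha : 0 < a) : vb b a a + vb (-b) a a + vb b a a + vb (-b) a a = 2 * wb b a a := by
  rw [vb_eq ha, vb_eq ha]
  unfold wb
  rw [min_self]
  split_ifs <;> first | (exfalso; omega) | norm_num

lemma vw_sym {x y a c : ℤ} (ha : 0 < a) (hc : 0 < c) :
    vw x y a c + vw y x a c + vw x y c a + vw y x c a = 2 * wI x y a c := by
  rw [wI_wb ha hc]
  have e : ∀ a c, vw x y a c = vb (x - y) a c := fun _ _ => rfl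
  have e2 : ∀ a c, vw y x a c = vb (-(x - y)) a c := fun _ _ => by rw [neg_sub]; rfl
  rw [e, e, e2, e2]
  rcases lt_trichotomy a c with h | h | h
  · exact vb_sym_lt ha h
  · subst h; exact vb_sym_eq ha
  · have := vb_sym_lt (b := x - y) hc h
    have e3 : wb (x - y) a c = wb (x - y) c a := by
      unfold wb; simp only [min_comm a c, eq_comm]
    rw [e3, ← this]; ring

/-- box of all solutions -/
noncomputable def Un (n : ℤ) : Finset Z4 :=
  (Icc (-4*n) (4*n) ×ˢ Icc (-4*n) (4*n) ×ˢ Icc (-4*n) (4*n) ×ˢ Icc (-4*n) (4*n)).filter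
    (fun v => 0 < v.2.2.1 ∧ 0 < v.2.2.2 ∧ v.1 * v.2.1 + v.2.2.1 * v.2.2.2 = n)

lemma mem_Un {n x y a c : ℤ} : (x, y, a, c) ∈ Un n ↔
    (-4*n ≤ x ∧ x ≤ 4*n) ∧ (-4*n ≤ y ∧ y ≤ 4*n) ∧ a ≤ 4*n ∧ c ≤ 4*n ∧ 0 < a ∧ 0 < c ∧ x * y + a * c = n := by
  simp only [Un, mem_filter, mem_product, mem_Icc]
  constructor
  · rintro ⟨⟨h1, h2, h3, h4⟩, h5, h6, h⟩
    exact ⟨h1, h2, h3.2, h4.2, h5, h6, h⟩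
  · rintro ⟨h1, h2, h3, h4, h5, h6, h⟩
    exact ⟨⟨h1, h2, ⟨by omega, h3⟩, ⟨by omega, h4⟩⟩, h5, h6, h⟩

lemma sumU_s1 (n : ℤ) (f : ℤ → ℤ → ℤ → ℤ → ℚ) :
    ∑ v ∈ Un n, f v.2.1 v.1 v.2.2.1 v.2.2.2 = ∑ v ∈ Un n, f v.1 v.2.1 v.2.2.1 v.2.2.2 := by
  refine Finset.sum_nbij' (fun v => (v.2.1, v.1, v.2.2.1, v.2.2.2))
    (fun v => (v.2.1, v.1, v.2.2.1, v.2.2.2)) ?_ ?_ ?_ ?_ ?_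
  iterate 2
    rintro ⟨x, y, a, c⟩ h
    rw [mem_Un] at h ⊢; obtain ⟨h1, h2, h3, h4, h5, h6, h⟩ := h
    exact ⟨h2, h1, h3, h4, h5, h6, by linarith⟩
  all_goals intros; rfl

lemma sumU_s2 (n : ℤ) (f : ℤ → ℤ → ℤ → ℤ → ℚ) :
    ∑ v ∈ Un n, f v.1 v.2.1 v.2.2.2 v.2.2.1 = ∑ v ∈ Un n, f v.1 v.2.1 v.2.2.1 v.2.2.2 := by
  refine Finset.sum_nbij' (fun v => (v.1, v.2.1, v.2.2.2, v.2.2.1))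
    (fun v => (v.1, v.2.1, v.2.2.2, v.2.2.1)) ?_ ?_ ?_ ?_ ?_
  iterate 2
    rintro ⟨x, y, a, c⟩ h
    rw [mem_Un] at h ⊢; obtain ⟨h1, h2, h3, h4, h5, h6, h⟩ := h
    exact ⟨h1, h2, h4, h3, h6, h5, by linarith⟩
  all_goals intros; rfl

lemma sumU_s3 (n : ℤ) (f : ℤ → ℤ → ℤ → ℤ → ℚ) :
    ∑ v ∈ Un n, f (-v.1) (-v.2.1) v.2.2.1 v.2.2.2 = ∑ v ∈ Un n, f v.1 v.2.1 v.2.2.1 v.2.2.2 := by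
  refine Finset.sum_nbij' (fun v => (-v.1, -v.2.1, v.2.2.1, v.2.2.2))
    (fun v => (-v.1, -v.2.1, v.2.2.1, v.2.2.2)) ?_ ?_ ?_ ?_ ?_
  iterate 2
    rintro ⟨x, y, a, c⟩ h
    rw [mem_Un] at h ⊢; obtain ⟨h1, h2, h3, h4, h5, h6, h⟩ := h
    dsimp only
    exact ⟨by omega, by omega, h3, h4, h5, h6, by linarith⟩
  all_goals intros; simp

lemma sumU_vw (n : ℤ) : ∑ v ∈ Un n, vw v.1 v.2.1 v.2.2.1 v.2.2.2 * ((v.1:ℚ) + v.2.1)^2 =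
    1/2 * ∑ v ∈ Un n, wI v.1 v.2.1 v.2.2.1 v.2.2.2 * ((v.1:ℚ) + v.2.1)^2 := by
  have e1 := sumU_s1 n (fun x y a c => vw x y a c * ((x:ℚ) + y)^2)
  have e2 := sumU_s2 n (fun x y a c => vw x y a c * ((x:ℚ) + y)^2)
  have e3 := sumU_s2 n (fun x y a c => vw y x a c * ((y:ℚ) + x)^2)
  rw [e1] at e3
  have key : ∑ v ∈ Un n, wI v.1 v.2.1 v.2.2.1 v.2.2.2 * ((v.1:ℚ) + v.2.1)^2 =
     1/2 * (∑ v ∈ Un n, vw v.1 v.2.1 v.2.2.1 v.2.2.2 * ((v.1:ℚ) + v.2.1)^2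
      + ∑ v ∈ Un n, vw v.2.1 v.1 v.2.2.1 v.2.2.2 * ((v.2.1:ℚ) + v.1)^2
      + ∑ v ∈ Un n, vw v.1 v.2.1 v.2.2.2 v.2.2.1 * ((v.1:ℚ) + v.2.1)^2
      + ∑ v ∈ Un n, vw v.2.1 v.1 v.2.2.2 v.2.2.1 * ((v.2.1:ℚ) + v.1)^2) := by
    rw [← sum_add_distrib, ← sum_add_distrib, ← sum_add_distrib, mul_sum]
    refine sum_congr rfl ?_
    rintro ⟨x, y, a, c⟩ h
    rw [mem_Un] at h
    obtain ⟨-, -, -, -, h5, h6, h⟩ := h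
    have := vw_sym (x := x) (y := y) h5 h6
    dsimp only
    linear_combination -1/2 * ((x:ℚ) + y)^2 * this
  rw [e1, e2, e3] at key
  rw [key]; ring
end

section
open Finset
set_option linter.all false

lemma sumU_pos (n : ℤ) (F : ℤ → ℤ → ℤ → ℤ → ℚ) :
    ∑ v ∈ Un n, (if 0 < v.1 ∧ 0 < v.2.1 then F v.1 v.2.1 v.2.2.1 v.2.2.2 else 0) =
    ∑ v ∈ Pn n, F v.1 v.2.1 v.2.2.1 v.2.2.2 := by
  rw [← sum_filter]
  refine sum_congr ?_ fun _ _ => rfl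
  ext ⟨x, y, a, c⟩
  rw [mem_filter, mem_Un, mem_Pn]
  dsimp only
  constructor
  · rintro ⟨⟨h1, h2, h3, h4, h5, h6, h⟩, h7, h8⟩
    exact ⟨h7, h8, h5, h6, h⟩
  · rintro ⟨h7, h8, h5, h6, h⟩
    have := mul_pos h7 h8
    have := mul_pos h5 h6
    have a1 : x ≤ n := by nlinarith
    have a2 : y ≤ n := by nlinarith
    have a3 : a ≤ n := by nlinarith
    have a4 : c ≤ n := by nlinarith
    exact ⟨⟨by omega, by omega, by omega, by omega, h5, h6, h⟩, h7, h8⟩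

lemma wI_swap {x y a c : ℤ} (ha : 0 < a) (hc : 0 < c) : wI y x a c = wI x y a c := by
  rw [wI_wb ha hc, wI_wb ha hc]
  unfold wb
  split_ifs <;> first | rfl | (exfalso; omega)

lemma wI_nonpos {x y a c : ℤ} (ha : 0 < a) (hc : 0 < c) (h : wI x y a c ≠ 0) : x - y ≤ a ∧ x - y ≤ c := by
  rw [wI_wb ha hc] at h
  unfold wb at h
  split_ifs at h <;> first | omega | exact absurd rfl h

lemma wII_eq {x y a c : ℤ} (hx : 0 < x) (hy : y < 0) (ha : 0 < a) (hc : 0 < c) :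
    wII x (c + y) (a - x) c = wI x y a c := by
  unfold wII wI
  rw [show c - (c + y) = -y by ring, show c + y - x = c - x + y by ring, show a - x + (c + y) - c = a - x + y by ring,
    sg_pos (show 0 < -y by omega), sg_pos (show 0 < a + x - y by omega), sg_pos (show 0 < c + x - y by omega)]
  rcases sg_cases (a - x + y) with ⟨h1, e1⟩ | ⟨h1, e1⟩ | ⟨h1, e1⟩ <;>
  rcases sg_cases (c - x + y) with ⟨h2, e2⟩ | ⟨h2, e2⟩ | ⟨h2, e2⟩ <;>
  rcases sg_cases (a - c) with ⟨h5, e5⟩ | ⟨h5, e5⟩ | ⟨h5, e5⟩ <;>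
  first
    | (exfalso; omega)
    | (rw [e1, e2, e5]; norm_num)

lemma wII_ne {x y a c : ℤ} (h : wII x y a c ≠ 0) : y < c ∧ x ≤ y ∧ c ≤ a + y := by
  unfold wII at h
  rcases sg_cases (c - y) with ⟨h1, e1⟩ | ⟨h1, e1⟩ | ⟨h1, e1⟩ <;>
  rcases sg_cases (y - x) with ⟨h2, e2⟩ | ⟨h2, e2⟩ | ⟨h2, e2⟩ <;>
  rcases sg_cases (a + y - c) with ⟨h3, e3⟩ | ⟨h3, e3⟩ | ⟨h3, e3⟩ <;>
  first
    | omega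
    | (exfalso; rw [e1, e2, e3] at h; norm_num at h)

lemma sumU_mixed (n : ℤ) :
    ∑ v ∈ Un n, (if 0 < v.1 ∧ v.2.1 < 0 then wI v.1 v.2.1 v.2.2.1 v.2.2.2 * ((v.1:ℚ) + v.2.1)^2 else 0) =
    ∑ v ∈ Pn n, wII v.1 v.2.1 v.2.2.1 v.2.2.2 * ((v.1:ℚ) + v.2.1 - v.2.2.2)^2 := by
  rw [← sum_filter]
  rw [← sum_filter_of_ne (p := fun v : Z4 => v.1 - v.2.1 ≤ v.2.2.1 ∧ v.1 - v.2.1 ≤ v.2.2.2) (s := filter _ _)]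
  rw [← sum_filter_of_ne (p := fun v : Z4 => v.2.1 < v.2.2.2 ∧ v.1 ≤ v.2.1 ∧ v.2.2.2 ≤ v.2.2.1 + v.2.1) (s := Pn n)]
  · refine Finset.sum_nbij' (fun v => (v.1, v.2.2.2 + v.2.1, v.2.2.1 - v.1, v.2.2.2))
      (fun v => (v.1, v.2.1 - v.2.2.2, v.2.2.1 + v.1, v.2.2.2)) ?_ ?_ ?_ ?_ ?_
    · rintro ⟨x, y, a, c⟩ h
      simp only [mem_filter, mem_Un] at h
      simp only [mem_filter, mem_Pn]
      obtain ⟨⟨⟨h1, h2, h3, h4, h5, h6, h⟩, h7, h8⟩, h9, h10⟩ := h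
      exact ⟨⟨h7, by omega, by omega, h6, by linarith⟩, by omega, by omega, by omega⟩
    · rintro ⟨x, y, a, c⟩ h
      simp only [mem_filter, mem_Pn] at h
      simp only [mem_filter, mem_Un]
      obtain ⟨⟨h1, h2, h3, h4, h⟩, h5, h6, h7⟩ := h
      have := mul_pos h1 h2
      have := mul_pos h3 h4
      have a1 : x ≤ n := by nlinarith
      have a2 : y ≤ n := by nlinarith
      have a3 : a ≤ n := by nlinarith
      have a4 : c ≤ n := by nlinarith
      exact ⟨⟨⟨by omega, by omega, by omega, by omega, by omega, h4, by linarith⟩, h1, by omega⟩, by omega, by omega⟩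
    · rintro ⟨x, y, a, c⟩ h; simp
    · rintro ⟨x, y, a, c⟩ h; simp
    · rintro ⟨x, y, a, c⟩ h
      simp only [mem_filter, mem_Un] at h
      obtain ⟨⟨⟨h1, h2, h3, h4, h5, h6, h⟩, h7, h8⟩, h9, h10⟩ := h
      dsimp only
      rw [wII_eq h7 h8 h5 h6]
      push_cast; ring
  · rintro ⟨x, y, a, c⟩ - h
    exact wII_ne (left_ne_zero_of_mul h)
  · rintro ⟨x, y, a, c⟩ h0 h
    simp only [mem_filter, mem_Un] at h0
    obtain ⟨⟨h1, h2, h3, h4, h5, h6, _⟩, h7, h8⟩ := h0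
    exact wI_nonpos h5 h6 (left_ne_zero_of_mul h)

lemma sumU_split (n : ℤ) : ∑ v ∈ Un n, wI v.1 v.2.1 v.2.2.1 v.2.2.2 * ((v.1:ℚ) + v.2.1)^2 =
    2 * ∑ v ∈ Pn n, WT v.1 v.2.1 v.2.2.1 v.2.2.2
    + 2 * ∑ v ∈ Un n, (if v.1 = 0 then wI v.1 v.2.1 v.2.2.1 v.2.2.2 * ((v.1:ℚ) + v.2.1)^2 else 0) := by
  set g : ℤ → ℤ → ℤ → ℤ → ℚ := fun x y a c => wI x y a c * ((x:ℚ) + y)^2 with hg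
  have gs : ∀ x y a c, 0 < a → 0 < c → g y x a c = g x y a c := by
    intro x y a c ha hc
    simp only [hg]; rw [wI_swap ha hc]; ring
  have gn : ∀ x y a c, 0 < a → 0 < c → g (-x) (-y) a c = g x y a c := by
    intro x y a c ha hc
    rw [← gs x y a c ha hc]
    simp only [hg]; unfold wI
    rw [show a - -x + -y = a - y + x by ring, show a + -x - -y = a + y - x by ring,
      show c - -x + -y = c - y + x by ring, show c + -x - -y = c + y - x by ring]
    push_cast; ring
  have e1 := sumU_pos n g
  have e2 := sumU_s3 n (fun x y a c => if 0 < x ∧ 0 < y then g x y a c else 0)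
  rw [e1] at e2
  have e3 := sumU_mixed n
  have e4 := sumU_s1 n (fun x y a c => if 0 < x ∧ y < 0 then g x y a c else 0)
  have e3' : ∑ v ∈ Un n, (if 0 < v.1 ∧ v.2.1 < 0 then g v.1 v.2.1 v.2.2.1 v.2.2.2 else 0) = 
     ∑ v ∈ Pn n, wII v.1 v.2.1 v.2.2.1 v.2.2.2 * ((v.1:ℚ) + v.2.1 - v.2.2.2)^2 := e3
  rw [e3'] at e4
  have e5 := sumU_s1 n (fun x y a c => if x = 0 then g x y a c else 0)
  have key : ∑ v ∈ Un n, g v.1 v.2.1 v.2.2.1 v.2.2.2 =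
    ∑ v ∈ Un n, (if 0 < v.1 ∧ 0 < v.2.1 then g v.1 v.2.1 v.2.2.1 v.2.2.2 else 0)
    + ∑ v ∈ Un n, (if 0 < -v.1 ∧ 0 < -v.2.1 then g (-v.1) (-v.2.1) v.2.2.1 v.2.2.2 else 0)
    + ∑ v ∈ Un n, (if 0 < v.1 ∧ v.2.1 < 0 then g v.1 v.2.1 v.2.2.1 v.2.2.2 else 0)
    + ∑ v ∈ Un n, (if 0 < v.2.1 ∧ v.1 < 0 then g v.2.1 v.1 v.2.2.1 v.2.2.2 else 0)
    + ∑ v ∈ Un n, (if v.1 = 0 then g v.1 v.2.1 v.2.2.1 v.2.2.2 else 0)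
    + ∑ v ∈ Un n, (if v.2.1 = 0 then g v.2.1 v.1 v.2.2.1 v.2.2.2 else 0) := by
    simp only [← sum_add_distrib]
    refine sum_congr rfl ?_
    rintro ⟨x, y, a, c⟩ h
    rw [mem_Un] at h
    obtain ⟨-, -, -, -, h5, h6, h⟩ := h
    dsimp only
    rw [gn x y a c h5 h6, gs x y a c h5 h6]
    by_cases h00 : x = 0 ∧ y = 0
    · obtain ⟨rfl, rfl⟩ := h00
      simp [hg]
    · split_ifs <;> first | (exfalso; omega) | ring
  have e6 : ∑ v ∈ Pn n, WT v.1 v.2.1 v.2.2.1 v.2.2.2 = ∑ v ∈ Pn n, g v.1 v.2.1 v.2.2.1 v.2.2.2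
     + ∑ v ∈ Pn n, wII v.1 v.2.1 v.2.2.1 v.2.2.2 * ((v.1:ℚ) + v.2.1 - v.2.2.2)^2 := by
    rw [← sum_add_distrib]; rfl
  show ∑ v ∈ Un n, g v.1 v.2.1 v.2.2.1 v.2.2.2 = 2 * _ + 2 * ∑ v ∈ Un n, (if v.1 = 0 then g v.1 v.2.1 v.2.2.1 v.2.2.2 else 0)
  rw [key, e1, e2, e3', e4, e5, e6]
  ring

lemma sq_sum (m : ℕ) : ∑ y ∈ Icc (-(m:ℤ)) m, (y:ℚ)^2 = m * (m+1) * (2*m+1) / 3 := by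
  induction m with
  | zero => simp
  | succ m ih =>
    have : Icc (-((m+1:ℕ):ℤ)) ((m+1:ℕ):ℤ) = insert ((m:ℤ)+1) (insert (-((m:ℤ)+1)) (Icc (-(m:ℤ)) m)) := by
      ext z; simp only [mem_Icc, mem_insert]; omega
    rw [this, sum_insert, sum_insert, ih]
    · push_cast; ring
    · simp
    · simp only [mem_Icc, mem_insert]; omega

lemma wb_sum (a c : ℕ) (K : ℤ) (ha : 0 < a) (hc : 0 < c) (hK : (min a c : ℕ) ≤ K) :
    ∑ y ∈ Icc (-K) K, wb (0 - y) a c * (y:ℚ)^2 = (2 * (min a c : ℕ)^3 + (min a c : ℕ))/3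
      - (1/3) * (if a = c then (a:ℚ)^2 else 0) := by
  set m := min a c with hm
  have hm0 : 0 < m := by omega
  have hmz : min (a:ℤ) c = m := by omega
  set w : ℚ := if a = c then 1/3 else 1/2 with hw
  have e : ∀ y ∈ Icc (-K) K, wb (0 - y) a c * (y:ℚ)^2 = (if y ∈ Icc (-(m:ℤ)) m then (y:ℚ)^2 else 0)
      + ((if y = (m:ℤ) then (w-1)*(m:ℚ)^2 else 0) + (if y = -(m:ℤ) then (w-1)*(m:ℚ)^2 else 0)) := by
    intro y _
    unfold wb
    rw [hmz]
    have hac : ((a:ℤ) = c) = (a = c) := by simp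
    simp only [hac]
    rw [← hw]
    simp only [mem_Icc]
    by_cases h1 : y = m
    · subst h1
      rw [if_neg (by omega), if_pos (by omega), if_pos (by omega), if_pos rfl, if_neg (by omega)]
      push_cast; ring
    by_cases h2 : y = -m
    · subst h2
      rw [if_neg (by omega), if_pos (by omega), if_pos (by omega), if_neg (by omega), if_pos rfl]
      push_cast; ring
    rw [if_neg h1, if_neg h2]
    by_cases h3 : -(m:ℤ) ≤ y ∧ y ≤ m
    · rw [if_pos h3, if_pos (by omega)]; ring
    · rw [if_neg h3, if_neg (by omega), if_neg (by omega)]; ring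
  rw [sum_congr rfl e, sum_add_distrib, sum_add_distrib, sum_ite_mem, sum_ite_eq', sum_ite_eq',
    if_pos (by rw [mem_Icc]; omega), if_pos (by rw [mem_Icc]; omega),
    inter_eq_right.2 (Icc_subset_Icc (by omega) (by omega)), sq_sum]
  by_cases h : a = c
  · have : m = a := by omega
    rw [hw, if_pos h, if_pos h, this]; ring
  · rw [hw, if_neg h, if_neg h]; ring
end

section
open Finset
set_option linter.all false

/-- square contribution -/
def sqc (r : ℕ) : ℚ := ∑ j ∈ range (r + 1), (if (3:ℕ)^j = 3^(r-j) then (((3^j : ℕ)):ℚ)^2 else 0)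

lemma sumU_zero (r : ℕ) : ∑ v ∈ Un (3^r), (if v.1 = 0 then wI v.1 v.2.1 v.2.2.1 v.2.2.2 * ((v.1:ℚ) + v.2.1)^2 else 0)
    = ∑ j ∈ range (r + 1), (2 * (min (3^j) (3^(r-j)) : ℕ)^3 + (min (3^j) (3^(r-j)) : ℕ) : ℚ)/3 - 1/3 * sqc r := by
  have e0 : ∀ j ∈ range (r + 1), ∑ y ∈ Icc (-(4 * (3:ℤ)^r)) (4 * 3^r), wb (0 - y) ((3^j : ℕ) : ℤ) ((3^(r-j) : ℕ) : ℤ) * (y:ℚ)^2 =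
      (2 * (min (3^j) (3^(r-j)) : ℕ)^3 + (min (3^j) (3^(r-j)) : ℕ) : ℚ)/3 - 1/3 * 
        (if (3:ℕ)^j = 3^(r-j) then (((3^j : ℕ)):ℚ)^2 else 0) := by
    intro j hj
    rw [mem_range] at hj
    refine wb_sum _ _ _ (by positivity) (by positivity) ?_
    have h1 : (3:ℕ)^j ≤ 3^r := Nat.pow_le_pow_right (by norm_num) (by omega)
    have h2 : min (3^j) (3^(r-j)) ≤ 4 * 3^r := by omega
    exact_mod_cast h2
  unfold sqc
  rw [mul_sum, ← sum_sub_distrib, ← sum_congr rfl e0, sum_sigma', ← sum_filter]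
  symm
  refine sum_bij (fun p _ => ((0, p.2, ((3^p.1 : ℕ) : ℤ), ((3^(r-p.1) : ℕ) : ℤ)) : Z4)) ?_ ?_ ?_ ?_
  · rintro ⟨j, y⟩ h
    simp only [mem_sigma, mem_range, mem_Icc] at h
    rw [mem_filter, mem_Un]
    obtain ⟨h1, h2, h3⟩ := h
    have hp : (0:ℤ) < 3^r := by positivity
    have b1 : (3:ℤ)^j ≤ 3^r := pow_le_pow_right₀ (by norm_num) (by omega)
    have b2 : (3:ℤ)^(r-j) ≤ 3^r := pow_le_pow_right₀ (by norm_num) (by omega)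
    refine ⟨⟨by omega, by dsimp only; omega, by push_cast; omega, by push_cast; omega, by positivity, by positivity, ?_⟩, rfl⟩
    push_cast
    rw [← pow_add, zero_mul, zero_add]; congr 1; omega
  · rintro ⟨j, y⟩ _ ⟨j', y'⟩ _ h
    simp only [Prod.mk.injEq] at h
    obtain ⟨-, h2, h1, -⟩ := h
    have : j = j' := by
      have : (3:ℕ)^j = 3^j' := by exact_mod_cast h1
      exact Nat.pow_right_injective (le_refl _ : 2 ≤ 2).step this
    subst this
    subst h2; rfl
  · rintro ⟨x, y, a, c⟩ h
    rw [mem_filter, mem_Un] at h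
    obtain ⟨⟨h1, h2, h3, h4, h5, h6, h⟩, h7⟩ := h
    dsimp only at h7; subst h7
    have hd : a.natAbs ∣ 3 ^ r := by
      have : a ∣ 3 ^ r := ⟨c, by linarith⟩
      have := Int.natAbs_dvd_natAbs.mpr this
      rwa [Int.natAbs_pow] at this
    obtain ⟨j, hj, hx⟩ := (Nat.dvd_prime_pow Nat.prime_three).1 hd
    have hx' : a = 3 ^ j := by
      have : (a.natAbs : ℤ) = a := Int.natAbs_of_nonneg h5.le
      rw [← this, hx]; push_cast; rfl
    subst hx'
    have hs : c = 3 ^ (r - j) := by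
      have e : (3:ℤ)^j * c = 3 ^ j * 3 ^ (r - j) := by
        rw [← pow_add, show j + (r - j) = r by omega]; linarith
      exact mul_left_cancel₀ (by positivity) e
    refine ⟨⟨j, y⟩, ?_, ?_⟩
    · simp only [mem_sigma, mem_range, mem_Icc]
      exact ⟨by omega, by omega, by omega⟩
    · simp only [hs]; push_cast; rfl
  · rintro ⟨j, y⟩ h
    dsimp only
    rw [wI_wb (by positivity) (by positivity)]; push_cast; ring

lemma sumU_vw_three (r : ℕ) : ∑ v ∈ Un (3^r), vw v.1 v.2.1 v.2.2.1 v.2.2.2 * ((v.1:ℚ) + v.2.1)^2 =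
    totR r + 2/3 * sqc r := by
  rw [sumU_vw, sumU_split, sumU_zero, sum_WT_eq, SE_sum]
  unfold totR cfun sqc
  rw [sum_sub_distrib, sum_add_distrib, ← mul_sum]
  ring

noncomputable def Hq (N : ℤ) : ℚ := ∑ Q ∈ RedF N, wR Q + if N = 0 then -1/12 else 0

lemma Hq_eq (N : ℤ) : hurwitzClassNumber N = (Hq N : ℝ) := by
  by_cases h : N = 0
  · subst h
    have : RedF 0 = ∅ := by
      rw [eq_empty_iff_forall_notMem]
      intro Q hQ
      rw [mem_RedF] at hQ
      have := hQ.1.posdef.2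
      rw [hQ.2] at this; simp at this
    unfold Hq
    rw [this]; simp [hurwitzClassNumber]; norm_num
  · rw [hurwitz_eq h, Hq, if_neg h]; push_cast; ring

lemma sum_RedF (n : ℤ) (hn : 0 < n) : ∑ t ∈ Icc (-(4*n)) (4*n), (t:ℚ)^2 * ∑ Q ∈ RedF (4*n - t^2), wR Q =
    ∑ v ∈ Un n, vw v.1 v.2.1 v.2.2.1 v.2.2.2 * ((v.1:ℚ) + v.2.1)^2 := by
  simp only [mul_sum]
  rw [sum_sigma']
  have e : ∑ v ∈ Un n, vw v.1 v.2.1 v.2.2.1 v.2.2.2 * ((v.1:ℚ) + v.2.1)^2 =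
    ∑ v ∈ (Un n).filter (fun v => D0 (v.2.2.1, v.1 - v.2.1, v.2.2.2)),
      wR (v.2.2.1, v.1 - v.2.1, v.2.2.2) * ((v.1:ℚ) + v.2.1)^2 := by
    rw [sum_filter]
    refine sum_congr rfl fun v _ => ?_
    unfold vw; split_ifs <;> ring
  rw [e]
  refine sum_nbij' (fun p => (((p.1 + p.2.2.1)/2, (p.1 - p.2.2.1)/2, p.2.1, p.2.2.2) : Z4))
    (fun v => ⟨v.1 + v.2.1, (v.2.2.1, v.1 - v.2.1, v.2.2.2)⟩) ?_ ?_ ?_ ?_ ?_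
  · rintro ⟨t, a, b, c⟩ h
    simp only [mem_sigma, mem_Icc, mem_RedF, D0, formDisc] at h
    rw [mem_filter, mem_Un]
    dsimp only
    obtain ⟨ht, ⟨h1, h2, h3, h4, h5⟩, h6⟩ := h
    have par : (2:ℤ) ∣ t - b := by
      have : (2:ℤ) ∣ (t - b) * (t - b) := ⟨b^2 - t * b + 2 * (n - a * c), by linarith⟩
      rcases Int.prime_two.dvd_mul.1 this with h | h <;> exact h
    obtain ⟨y, hy⟩ := par
    have hx : t + b = 2 * (y + b) := by omega
    rw [hx, hy, Int.mul_ediv_cancel_left _ (by norm_num), Int.mul_ediv_cancel_left _ (by norm_num)]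
    have ht2 : t = 2 * y + b := by omega
    have hb : b^2 ≤ a * c := by nlinarith
    have hc : c ≤ a * c := by nlinarith
    have hc4 : c ≤ 4 * n := by nlinarith [sq_nonneg t]
    have hs : (y + b) * y + a * c = n := by subst ht2; linarith
    have hbb : y + b - y = b := by ring
    rw [hbb]
    exact ⟨⟨by omega, by omega, by omega, by omega, h1, by omega, hs⟩, h1, h2, h3, h4, h5⟩
  · rintro ⟨x, y, a, c⟩ h
    simp only [mem_filter, mem_Un] at h
    obtain ⟨⟨_, _, _, _, h5, h6, h⟩, hD⟩ := h
    have hd := hD.posdef.2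
    simp only [mem_sigma, mem_Icc, mem_RedF, formDisc] at hd ⊢
    have ht : (x + y)^2 < 4 * n := by nlinarith
    refine ⟨⟨by nlinarith, by nlinarith⟩, hD, by rw [← h]; ring⟩
  · rintro ⟨t, a, b, c⟩ h
    simp only [mem_sigma, mem_Icc, mem_RedF, D0, formDisc] at h
    obtain ⟨ht, ⟨h1, h2, h3, h4, h5⟩, h6⟩ := h
    have par : (2:ℤ) ∣ t - b := by
      have : (2:ℤ) ∣ (t - b) * (t - b) := ⟨b^2 - t * b + 2 * (n - a * c), by linarith⟩
      rcases Int.prime_two.dvd_mul.1 this with h | h <;> exact h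
    obtain ⟨y, hy⟩ := par
    have e1 : (t + b) / 2 + (t - b) / 2 = t := by omega
    have e2 : (t + b) / 2 - (t - b) / 2 = b := by omega
    simp only [e1, e2]
  · rintro ⟨x, y, a, c⟩ h
    have e1 : (x + y + (x - y)) / 2 = x := by omega
    have e2 : (x + y - (x - y)) / 2 = y := by omega
    simp only [e1, e2]
  · rintro ⟨t, a, b, c⟩ h
    simp only [mem_sigma, mem_Icc, mem_RedF, D0, formDisc] at h
    obtain ⟨ht, ⟨h1, h2, h3, h4, h5⟩, h6⟩ := h
    have par : (2:ℤ) ∣ t - b := by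
      have : (2:ℤ) ∣ (t - b) * (t - b) := ⟨b^2 - t * b + 2 * (n - a * c), by linarith⟩
      rcases Int.prime_two.dvd_mul.1 this with h | h <;> exact h
    obtain ⟨y, hy⟩ := par
    have e1 : (t + b) / 2 + (t - b) / 2 = t := by omega
    have e2 : (t + b) / 2 - (t - b) / 2 = b := by omega
    simp only [e2]
    rw [← Int.cast_add, e1]; ring

lemma sqc_odd (k : ℕ) : sqc (2*k+1) = 0 := by
  unfold sqc
  refine sum_eq_zero fun j hj => ?_
  rw [if_neg]
  intro h
  have := Nat.pow_right_injective (le_refl _ : 2 ≤ 2).step h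
  rw [mem_range] at hj
  omega
lemma sqc_even (k : ℕ) : sqc (2*k) = (3:ℚ)^(2*k) := by
  unfold sqc
  rw [sum_eq_single k]
  · rw [if_pos (by congr 1; omega)]; push_cast; ring
  · intro j hj hk
    rw [mem_range] at hj
    rw [if_neg]
    intro h
    have := Nat.pow_right_injective (le_refl _ : 2 ≤ 2).step h
    omega
  · intro h; exfalso; apply h; rw [mem_range]; omega

lemma sq_four (r : ℕ) (t : ℤ) (h : t^2 = 4 * 3^r) : ∃ k, r = 2 * k ∧ (t = 2 * 3^k ∨ t = -(2 * 3^k)) := by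
  have h2 : (2:ℤ) ∣ t := by
    have : (2:ℤ) ∣ t^2 := ⟨2 * 3^r, by rw [h]; ring⟩
    exact Int.prime_two.dvd_of_dvd_pow this
  obtain ⟨u, rfl⟩ := h2
  have hu : u^2 = 3^r := by linarith
  have hd : u.natAbs ∣ 3 ^ r := by
    have : u ∣ 3 ^ r := ⟨u, by rw [← hu]; ring⟩
    have := Int.natAbs_dvd_natAbs.mpr this
    rwa [Int.natAbs_pow] at this
  obtain ⟨j, hj, hx⟩ := (Nat.dvd_prime_pow Nat.prime_three).1 hd
  have h3 : u.natAbs ^ 2 = 3^r := by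
    have := congrArg Int.natAbs hu
    rwa [Int.natAbs_pow, Int.natAbs_pow] at this
  rw [hx, ← pow_mul] at h3
  have h4 := Nat.pow_right_injective (le_refl _ : 2 ≤ 2).step h3
  refine ⟨j, by omega, ?_⟩
  rcases Int.natAbs_eq u with h | h
  · left; rw [h, hx]; push_cast; rfl
  · right; rw [h, hx]; push_cast; ring

lemma sum_sq (r : ℕ) : ∑ t ∈ Icc (-(4*(3:ℤ)^r)) (4*3^r), (if 4*3^r - t^2 = 0 then (t:ℚ)^2 else 0) = 8 * sqc r := by
  rcases Nat.even_or_odd' r with ⟨k, rfl | rfl⟩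
  · rw [sqc_even, ← sum_filter]
    have : (Icc (-(4*(3:ℤ)^(2*k))) (4*3^(2*k))).filter (fun t => 4*3^(2*k) - t^2 = 0) = {2*3^k, -(2*3^k)} := by
      ext t
      simp only [mem_filter, mem_Icc, mem_insert, mem_singleton]
      constructor
      · rintro ⟨-, h⟩
        obtain ⟨k', hk, h⟩ := sq_four (2*k) t (by linarith)
        obtain rfl : k = k' := by omega
        exact h
      · have b1 : (3:ℤ)^k ≤ 3^(2*k) := pow_le_pow_right₀ (by norm_num) (by omega)
        have hp : (0:ℤ) < 3^k := by positivity
        rintro (rfl | rfl)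
        · refine ⟨⟨by linarith, by linarith⟩, by ring⟩
        · refine ⟨⟨by linarith, by linarith⟩, by ring⟩
    rw [this, sum_pair]
    · push_cast; ring
    · have hp : (0:ℤ) < 3^k := by positivity
      omega
  · rw [sqc_odd, mul_zero]
    refine sum_eq_zero fun t _ => ?_
    rw [if_neg]
    intro h
    obtain ⟨k', hk, -⟩ := sq_four (2*k+1) t (by linarith)
    omega

lemma tot_eq (r : ℕ) : ∑ t ∈ Icc (-(4*(3:ℤ)^r)) (4*3^r), (t:ℚ)^2 * Hq (4 * 3^r - t^2) = totR r := by
  unfold Hq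
  simp only [mul_add]
  rw [sum_add_distrib, sum_RedF _ (by positivity), sumU_vw_three]
  have := sum_sq r
  have e : ∑ t ∈ Icc (-(4*(3:ℤ)^r)) (4*3^r), (t:ℚ)^2 * (if 4 * 3^r - t^2 = 0 then -1/12 else 0) = 
     -1/12 * ∑ t ∈ Icc (-(4*(3:ℤ)^r)) (4*3^r), (if 4*3^r - t^2 = 0 then (t:ℚ)^2 else 0) := by
    rw [mul_sum]; refine sum_congr rfl fun t _ => ?_
    split_ifs <;> ring
  rw [e, this]; ring
end

section
open Finset
set_option linter.all false

noncomputable def gR (r : ℕ) (t : ℤ) : ℝ := (t:ℝ)^2 * hurwitzClassNumber (4 * 3^r - t^2)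

lemma gR_zero (r : ℕ) (t : ℤ) (h : ¬ (-(4*(3:ℤ)^r) ≤ t ∧ t ≤ 4*3^r)) : gR r t = 0 := by
  unfold gR
  rw [hurwitz_neg, mul_zero]
  have hp : (0:ℤ) < 3^r := by positivity
  by_contra hc
  apply h
  constructor <;> nlinarith

noncomputable def Tt (r : ℕ) (K : ℤ) : ℝ := ∑ t ∈ Icc (-K) K, gR r t
noncomputable def Am (m : ℤ) (r : ℕ) (K : ℤ) : ℝ := ∑ t ∈ Icc (-K) K, if t % 3 = m then gR r t else 0

lemma Tt_eq (r : ℕ) (K : ℤ) (hK : 4 * 3^r ≤ K) : Tt r K = (totR r : ℝ) := by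
  rw [← tot_eq]
  push_cast
  unfold Tt
  symm
  have : ∀ t : ℤ, (t:ℝ)^2 * ((Hq (4*3^r - t^2) : ℚ):ℝ) = gR r t := by
    intro t; unfold gR; rw [Hq_eq]
  simp only [this]
  apply sum_subset
  · intro t; rw [mem_Icc, mem_Icc]; omega
  · intro t _ h; rw [mem_Icc] at h; exact gR_zero r t h

lemma sum_three (K : ℤ) (F : ℤ → ℝ) (hF : ∀ t, ¬ (-K ≤ t ∧ t ≤ K) → F t = 0) :
    ∑ t ∈ Icc (-K) K, (if t % 3 = 0 then F t else 0) = ∑ s ∈ Icc (-K) K, F (3*s) := by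
  rw [← sum_filter]
  have : ∑ s ∈ Icc (-K) K, F (3*s) = ∑ s ∈ (Icc (-K) K).filter (fun s => -K ≤ 3*s ∧ 3*s ≤ K), F (3*s) := by
    symm
    apply sum_subset (filter_subset _ _)
    intro t h1 h2
    apply hF
    intro h; exact h2 (mem_filter.2 ⟨h1, h⟩)
  rw [this]
  refine sum_nbij' (fun t => t/3) (fun s => 3*s) ?_ ?_ ?_ ?_ ?_
  · intro t h; simp only [mem_filter, mem_Icc] at h ⊢; omega
  · intro t h; simp only [mem_filter, mem_Icc] at h ⊢; omega
  · intro t h; simp only [mem_filter, mem_Icc] at h ⊢; omega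
  · intro t h; simp only [mem_filter, mem_Icc] at h ⊢; omega
  · intro t h; simp only [mem_filter, mem_Icc] at h
    congr 1; omega

lemma gR_nine (r : ℕ) (s : ℤ) : gR (r+2) (3*s) = 9 * ((s:ℝ)^2 * hurwitzClassNumber (9 * (4*3^r - s^2))) := by
  unfold gR
  rw [show (4 * 3^(r+2) - (3*s)^2 : ℤ) = 9 * (4*3^r - s^2) by ring]
  push_cast; ring

lemma gR_notdvd (r : ℕ) (s : ℤ) (h : s % 3 ≠ 0) : gR (r+3) (3*s) = 27 * gR (r+1) s := by
  rw [show r + 3 = (r+1) + 2 by ring, gR_nine, hecke_two]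
  · unfold gR; ring
  · have : s % 3 = 1 ∨ s % 3 = 2 := by omega
    rw [pow_succ]
    generalize (3:ℤ)^r = x
    rcases this with h | h
    · obtain ⟨k, rfl⟩ : ∃ k, s = 3*k+1 := ⟨s/3, by omega⟩
      exact ⟨-4*x + 3*k^2+2*k, by ring⟩
    · obtain ⟨k, rfl⟩ : ∃ k, s = 3*k+2 := ⟨s/3, by omega⟩
      exact ⟨-4*x + 3*k^2+4*k+1, by ring⟩

lemma gR_dvd3 (u : ℤ) : gR 3 (3*(3*u)) = 36 * gR 1 (3*u) := by
  rw [show 3 = 1 + 2 by rfl, gR_nine, hecke_zero]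
  · unfold gR; ring
  · exact ⟨4 - 3*u^2, by ring⟩
  · rintro ⟨k, hk⟩
    have : 9 * u^2 + 9 * k = 12 := by linarith
    generalize u^2 = v at this
    omega

lemma gR_dvd4 (r : ℕ) (u : ℤ) : gR (r+4) (3*(3*u)) = 36 * gR (r+2) (3*u) - 243 * gR r u := by
  rw [show r + 4 = (r+2) + 2 by ring, gR_nine]
  have e : (4 * 3^(r+2) - (3*u)^2 : ℤ) = 9 * (4*3^r - u^2) := by ring
  unfold gR
  rw [e, hecke_nine]
  push_cast; ring

lemma Am_three (r : ℕ) (K : ℤ) (hK : 4 * 3^r ≤ K) : Am 0 r K = ∑ s ∈ Icc (-K) K, gR r (3*s) := by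
  unfold Am
  apply sum_three
  intro t h; apply gR_zero; omega

lemma Am_rec4 (r : ℕ) (K : ℤ) (hK : 4 * 3^(r+4) ≤ K) :
    Am 0 (r+4) K = 27 * Tt (r+2) K + 9 * Am 0 (r+2) K - 243 * Tt r K := by
  have hp : (0:ℤ) < 3^r := by positivity
  have p2 : (3:ℤ)^(r+2) = 9 * 3^r := by ring
  have p4 : (3:ℤ)^(r+4) = 81 * 3^r := by ring
  have key : ∀ s : ℤ, gR (r+4) (3*s) = 27 * gR (r+2) s + (if s % 3 = 0 then (gR (r+4) (3*s) - 27 * gR (r+2) s) else 0) := by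
    intro s
    split_ifs with h
    · ring
    · rw [show r+4 = (r+1)+3 by ring, gR_notdvd _ _ h]; ring
  rw [Am_three _ _ hK, sum_congr rfl (fun s _ => key s), sum_add_distrib, ← mul_sum,
    sum_three K (fun s => gR (r+4) (3*s) - 27 * gR (r+2) s),
    Am_three (r+2) K (by omega)]
  · unfold Tt
    rw [mul_sum _ _ (9:ℝ), mul_sum _ _ (243:ℝ), add_sub_assoc, ← sum_sub_distrib]
    congr 1
    refine sum_congr rfl fun u _ => ?_
    rw [gR_dvd4]; ring
  · intro t ht
    rw [gR_zero _ _ (by omega), gR_zero _ _ (by omega)]; ring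

lemma Am_rec3 (K : ℤ) (hK : 108 ≤ K) :
    Am 0 3 K = 27 * Tt 1 K + 9 * Am 0 1 K := by
  have key : ∀ s : ℤ, gR 3 (3*s) = 27 * gR 1 s + (if s % 3 = 0 then (gR 3 (3*s) - 27 * gR 1 s) else 0) := by
    intro s
    split_ifs with h
    · ring
    · rw [show 3 = 0+3 by ring, gR_notdvd _ _ h]; ring
  rw [Am_three _ _ (by omega), sum_congr rfl (fun s _ => key s), sum_add_distrib, ← mul_sum,
    sum_three K (fun s => gR 3 (3*s) - 27 * gR 1 s),
    Am_three 1 K (by omega)]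
  · unfold Tt
    rw [mul_sum _ _ (9:ℝ)]
    congr 1
    refine sum_congr rfl fun u _ => ?_
    rw [gR_dvd3]; ring
  · intro t ht
    rw [gR_zero _ _ (by omega), gR_zero _ _ (by omega)]; ring

lemma H_zero : hurwitzClassNumber 0 = -1/12 := by
  unfold hurwitzClassNumber; rw [if_pos rfl]; norm_num

lemma H_three : hurwitzClassNumber 3 = 1/3 := by
  have h := Tt_eq 0 4 (by norm_num)
  rw [totR_zero] at h
  unfold Tt at h
  rw [show (Icc (-4) 4 : Finset ℤ) = {-4,-3,-2,-1,0,1,2,3,4} by decide] at h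
  simp [gR] at h
  norm_num at h
  rw [hurwitz_neg (by norm_num), hurwitz_neg (by norm_num), H_zero] at h
  linarith

lemma sum_small (b K : ℤ) (hb : b ≤ K) (F : ℤ → ℝ) (hF : ∀ t, ¬ (-b ≤ t ∧ t ≤ b) → F t = 0) :
    ∑ t ∈ Icc (-K) K, F t = ∑ t ∈ Icc (-b) b, F t := by
  symm
  apply sum_subset
  · intro t; rw [mem_Icc, mem_Icc]; omega
  · intro t _ h; rw [mem_Icc] at h; exact hF t h

lemma Am_one (K : ℤ) (hK : 12 ≤ K) : Am 0 1 K = 6 := by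
  rw [Am_three _ _ (by omega), sum_small 1 K (by omega)]
  · rw [show (Icc (-1) 1 : Finset ℤ) = {-1,0,1} by decide]
    simp [gR]
    norm_num
    rw [H_three]; norm_num
  · intro t ht
    unfold gR
    rw [hurwitz_neg, mul_zero]
    have : t ≤ -2 ∨ 2 ≤ t := by omega
    rcases this with h | h <;> nlinarith

lemma Am_two (K : ℤ) (hK : 36 ≤ K) : Am 0 2 K = 18 := by
  rw [Am_three _ _ (by omega), sum_small 2 K (by omega)]
  · rw [show (Icc (-2) 2 : Finset ℤ) = {-2,-1,0,1,2} by decide]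
    have h27 : hurwitzClassNumber 27 = 4/3 := by
      have := hecke_zero (N := 3) (by norm_num) (by norm_num)
      norm_num at this
      rw [this, H_three]; norm_num
    simp [gR]
    norm_num
    rw [h27, H_zero]; norm_num
  · intro t ht
    unfold gR
    rw [hurwitz_neg, mul_zero]
    have : t ≤ -3 ∨ 3 ≤ t := by omega
    rcases this with h | h <;> nlinarith

lemma totR_even (k : ℕ) : totR (2*k) = 3 * 81^k + 1/13 - 40/13 * 27^k := by
  induction k with
  | zero => rw [mul_zero, totR_zero]; norm_num
  | succ k ih =>
    rw [show 2 * (k+1) = 2*k + 2 by ring, totR_succ, ih, pow_add, pow_mul]; norm_num; ring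

lemma totR_odd (k : ℕ) : totR (2*k+1) = 27 * 81^k + 1/13 - 144/13 * 27^k := by
  induction k with
  | zero => rw [mul_zero, totR_one]; norm_num
  | succ k ih =>
    rw [show 2 * (k+1) + 1 = (2*k+1) + 2 by ring, totR_succ, ih, pow_add, pow_add, pow_mul]; norm_num; ring

lemma Am_even (k : ℕ) : ∀ K : ℤ, 4 * 3^(2*k+2) ≤ K →
    Am 0 (2*k+2) K = 81*81^k - (54 + 27/13 + 27) * 27^k + 18 * 9^k + 27/13 := by
  induction k with
  | zero => intro K hK; norm_num at hK ⊢; rw [Am_two K hK]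
  | succ k ih =>
    intro K hK
    have hp : (0:ℤ) < 3^(2*k) := by positivity
    have p2 : (3:ℤ)^(2*k+2) = 9 * 3^(2*k) := by ring
    have p4 : (3:ℤ)^(2*(k+1)+2) = 81 * 3^(2*k) := by ring
    rw [show 2*(k+1)+2 = 2*k+4 by ring, Am_rec4 _ _ (by rw [show 2*k+4 = 2*(k+1)+2 by ring]; exact hK),
      ih K (by omega), Tt_eq _ _ (by omega), Tt_eq _ _ (by omega), totR_even,
      show 2*k+2 = 2*(k+1) by ring, totR_even]
    push_cast; ring

lemma Am_odd (k : ℕ) : ∀ K : ℤ, 4 * 3^(2*k+1) ≤ K →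
    Am 0 (2*k+1) K = 9*81^k - 144/13 * 27^k + 6 * 9^k + 27/13 := by
  rcases k with _ | k
  · intro K hK; norm_num at hK ⊢; rw [Am_one K hK]
  induction k with
  | zero =>
    intro K hK; norm_num at hK ⊢
    rw [Am_rec3 K hK, Am_one K (by omega), Tt_eq 1 K (by omega), totR_one]; norm_num
  | succ k ih =>
    intro K hK
    have hp : (0:ℤ) < 3^(2*k+1) := by positivity
    have p2 : (3:ℤ)^(2*(k+1)+1) = 9 * 3^(2*k+1) := by ring
    have p4 : (3:ℤ)^(2*(k+1+1)+1) = 81 * 3^(2*k+1) := by ring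
    have e1 : Am 0 (2*(k+1+1)+1) K = Am 0 ((2*k+1)+4) K := rfl
    rw [e1, Am_rec4 (2*k+1) K hK, show 2*k+1+2 = 2*(k+1)+1 by ring,
      ih K (by omega), Tt_eq _ _ (by omega), Tt_eq _ _ (by omega), totR_odd, totR_odd]
    push_cast; ring

lemma Am_sum (r : ℕ) (K : ℤ) : Am 0 r K + Am 1 r K + Am 2 r K = Tt r K := by
  unfold Am Tt
  rw [← sum_add_distrib, ← sum_add_distrib]
  refine sum_congr rfl fun t _ => ?_
  have : t % 3 = 0 ∨ t % 3 = 1 ∨ t % 3 = 2 := by omega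
  rcases this with h | h | h <;> simp [h]

lemma Am_symm (r : ℕ) (K : ℤ) : Am 1 r K = Am 2 r K := by
  unfold Am
  refine sum_nbij' (fun t => -t) (fun t => -t) ?_ ?_ ?_ ?_ ?_
  · intro t h; rw [mem_Icc] at *; omega
  · intro t h; rw [mem_Icc] at *; omega
  · intro t _; ring
  · intro t _; ring
  · intro t _
    have e : gR r (-t) = gR r t := by unfold gR; push_cast; rw [neg_sq, neg_sq]
    rw [e]
    have : t % 3 = 1 ↔ -t % 3 = 2 := by omega
    simp only [this]

lemma HH_eq (m : ℤ) (r : ℕ) (h0 : 0 ≤ m) (h3 : m < 3) : HH 2 m 3 (3^r) = Am m r (4*3^r) := by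
  unfold HH Am
  have : m % 3 = m := Int.emod_eq_of_lt h0 h3
  rw [finsum_eq_sum_of_support_subset (s := Icc (-(4*3^r)) (4*3^r))]
  · refine sum_congr rfl fun t _ => ?_
    push_cast
    rw [this]; rfl
  · intro t ht
    rw [Function.mem_support] at ht
    rw [mem_coe, mem_Icc]
    by_contra h
    apply ht
    have := gR_zero r t h
    unfold gR at this
    push_cast
    rw [this]; simp
end

/-- Corollary 1.3 (2): for `r ≥ 1`,
`H_{2,0,3}(3^r) = -3^{3r/2} δ_{2∣r} - (27/13)(3^{3⌊(r-1)/2⌋}-1) + 3^r(3^r-1)`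
`- 3^{r+1}(3^{⌊(r-1)/2⌋}-1) - 3^{3r/2} δ_{2∣r}`, and for `m ∈ {1,2}`,
`H_{2,m,3}(3^r) = -1 + 3^{2r} - (3^r/2)(3^{⌊(r+1)/2⌋}-1) + 3^{r+1}(3^{⌊(r-1)/2⌋}-1)/2`. -/
theorem second_moment_power_of_three (r : ℕ) (hr : 0 < r) :
    HH 2 0 3 (3 ^ r) =
        -((3 : ℝ) ^ ((3 * (r : ℝ)) / 2) * (if 2 ∣ r then (1 : ℝ) else 0))
        - 27 / 13 * ((3 : ℝ) ^ (3 * ((r - 1) / 2)) - 1)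
        + (3 : ℝ) ^ r * ((3 : ℝ) ^ r - 1)
        - (3 : ℝ) ^ (r + 1) * ((3 : ℝ) ^ ((r - 1) / 2) - 1)
        - (3 : ℝ) ^ ((3 * (r : ℝ)) / 2) * (if 2 ∣ r then (1 : ℝ) else 0)
    ∧ ∀ m : ℤ, m = 1 ∨ m = 2 →
        HH 2 m 3 (3 ^ r) =
          -1 + (3 : ℝ) ^ (2 * r)
          - (3 : ℝ) ^ r / 2 * ((3 : ℝ) ^ ((r + 1) / 2) - 1)
          + (3 : ℝ) ^ (r + 1) * ((3 : ℝ) ^ ((r - 1) / 2) - 1) / 2 := by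
  have hB : ∀ m : ℤ, m = 1 ∨ m = 2 → HH 2 m 3 (3^r) = ((totR r : ℝ) - Am 0 r (4*3^r))/2 := by
    have h1 := Am_sum r (4*3^r)
    have h2 := Am_symm r (4*3^r)
    rw [Tt_eq r _ le_rfl] at h1
    rintro m (rfl | rfl)
    · rw [HH_eq _ _ (by norm_num) (by norm_num)]; linarith
    · rw [HH_eq _ _ (by norm_num) (by norm_num)]; linarith
  have p9 : ∀ k : ℕ, (9:ℝ)^k = (3^k)^2 := fun k => by rw [← pow_mul, mul_comm, pow_mul]; norm_num
  have p27 : ∀ k : ℕ, (27:ℝ)^k = (3^k)^3 := fun k => by rw [← pow_mul, mul_comm, pow_mul]; norm_num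
  have p81 : ∀ k : ℕ, (81:ℝ)^k = (3^k)^4 := fun k => by rw [← pow_mul, mul_comm, pow_mul]; norm_num
  obtain ⟨k, rfl | rfl⟩ : ∃ k, r = 2*k+1 ∨ r = 2*k+2 := ⟨(r-1)/2, by omega⟩
  · rw [HH_eq _ _ (by norm_num) (by norm_num)]
    refine ⟨?_, fun m hm => ?_⟩
    · rw [Am_odd k _ le_rfl, if_neg (by omega), show (2*k+1-1)/2 = k by omega, p9, p27, p81]
      ring
    · rw [hB m hm, Am_odd k _ le_rfl, totR_odd, show (2*k+1-1)/2 = k by omega,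
        show (2*k+1+1)/2 = k+1 by omega]
      push_cast
      rw [p9, p27, p81]
      ring
  · rw [HH_eq _ _ (by norm_num) (by norm_num)]
    refine ⟨?_, fun m hm => ?_⟩
    · have e : (3:ℝ) ^ ((3 * ((2*k+2 : ℕ):ℝ))/2) = 3^(3*k+3) := by
        rw [← Real.rpow_natCast]; congr 1; push_cast; ring
      rw [e, Am_even k _ le_rfl, if_pos (by omega), show (2*k+2-1)/2 = k by omega, p9, p27, p81]
      ring
    · rw [hB m hm, Am_even k _ le_rfl, show (2*k+2-1)/2 = k by omega,
        show (2*k+2+1)/2 = k+1 by omega, show (totR (2*k+2)) = totR (2*(k+1)) from rfl, totR_even]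
      push_cast
      rw [p9, p27, p81, p27, p81]
      ring

end HurwitzPaper
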